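/- Let (G,o) be a rooted graph distributed according to a stationary law L with E[log deg(o)] < ∞, and let X be the lazy random walk from o with Z_{s,t} = -log P^{t-s}(X_s, X_t). Then Z_{s,t} has the same distribution as Z_{0,t-s}, and Z_{0,t} ≤ Z_{0,s} + Z_{s,t} for 0 ≤ s ≤ t; consequently the asymptotic entropy H(G,o) = lim_{t→∞} (1/t) Σ_x P^t(o,x) log(1/P^t(o,x)) exists almost surely and in L¹ by Kingman's subadditive ergodic theorem. -/

import Mathlib

open scoped ENNReal Classical
open MeasureTheory Filter

/-- Rooted countable graphs are modeled as adjacency functions on `ℕ`, the root being `0`. -/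
abbrev Env : Type := ℕ → ℕ → Bool

/-- Relabeling the vertices of a graph by a permutation of `ℕ`. -/
def relabel (φ : ℕ ≃ ℕ) (A : Env) : Env := fun u v => A (φ.symm u) (φ.symm v)

/-- The degree of a vertex. -/
noncomputable def edeg (A : Env) (x : ℕ) : ℕ := {y | A x y = true}.ncard

/-- The lazy simple random walk kernel of the graph `A`. -/
noncomputable def ekernel (A : Env) (x y : ℕ) : ℝ :=
  if x = y then 1 / 2 else if A x y then 1 / (2 * (edeg A x : ℝ)) else 0

/-- `t`-step transition probabilities of the lazy simple random walk on `A`. -/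
noncomputable def ekernelPow (A : Env) : ℕ → ℕ → ℕ → ℝ
  | 0 => fun x y => if x = y then 1 else 0
  | (t + 1) => fun x y => ∑' u, ekernelPow A t x u * ekernel A u y

/-- A function of a rooted graph, invariant under rooted isomorphisms. -/
def Invariant (h : Env → ℕ → ℝ≥0∞) : Prop :=
  ∀ (φ : ℕ ≃ ℕ) (A : Env) (x : ℕ), h (relabel φ A) (φ x) = h A x

namespace MarkovErgodic

open ProbabilityTheory Topology

variable {S : Type*} [MeasurableSpace S]

/-- The action of a kernel on nonnegative functions. -/
noncomputable def act (κ : Kernel S S) (f : S → ℝ≥0∞) (x : S) : ℝ≥0∞ := ∫⁻ y, f y ∂κ x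

/-- The sums `f + T f + ⋯ + T ^ (n - 1) f` for the action `T` of a kernel. -/
noncomputable def ergodicSum (κ : Kernel S S) (f : S → ℝ≥0∞) : ℕ → S → ℝ≥0∞
  | 0 => 0
  | n + 1 => fun x => f x + act κ (ergodicSum κ f n) x

/-- The maximal function of Hopf's lemma associated with the difference `a - b`. -/
noncomputable def hopfMax (κ : Kernel S S) (a b : S → ℝ≥0∞) : ℕ → S → ℝ≥0∞
  | 0 => 0
  | n + 1 => fun x => (a x + act κ (hopfMax κ a b n) x) - b x

variable {κ : Kernel S S} {ν : Measure S} {f g a b : S → ℝ≥0∞}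

lemma measurable_act (hf : Measurable f) : Measurable (act κ f) := hf.lintegral_kernel

lemma act_mono (h : f ≤ g) : act κ f ≤ act κ g := fun _ => lintegral_mono h

lemma act_add (hf : Measurable f) :
    act κ (fun x => f x + g x) = fun x => act κ f x + act κ g x := by
  funext x
  exact lintegral_add_left hf _

lemma act_mono_ae (hinv : κ.Invariant ν) (h : f ≤ᵐ[ν] g) : act κ f ≤ᵐ[ν] act κ g := by
  have h' : ∀ᵐ x ∂(ν.bind κ), f x ≤ g x := by rw [hinv.def]; exact h
  filter_upwards [Measure.ae_ae_of_ae_comp h'] with x hx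
  exact lintegral_mono_ae hx

lemma act_congr_ae (hinv : κ.Invariant ν) (h : f =ᵐ[ν] g) : act κ f =ᵐ[ν] act κ g :=
  (act_mono_ae hinv h.le).antisymm (act_mono_ae hinv h.symm.le)

lemma lintegral_act (hinv : κ.Invariant ν) (hf : Measurable f) :
    ∫⁻ x, act κ f x ∂ν = ∫⁻ x, f x ∂ν := by
  conv_rhs => rw [← hinv.def]
  rw [Measure.lintegral_bind κ.aemeasurable hf.aemeasurable]
  rfl

lemma measurable_ergodicSum (hf : Measurable f) (n : ℕ) : Measurable (ergodicSum κ f n) := by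
  induction n with
  | zero => exact measurable_zero
  | succ n ih => exact hf.add (measurable_act ih)

lemma ergodicSum_add (hf : Measurable f) (n : ℕ) :
    ergodicSum κ (fun x => f x + g x) n
      = fun x => ergodicSum κ f n x + ergodicSum κ g n x := by
  induction n with
  | zero => funext x; simp [ergodicSum]
  | succ n ih =>
    funext x
    simp only [ergodicSum]
    rw [ih, act_add (measurable_ergodicSum hf n)]
    ring

lemma ergodicSum_const [IsMarkovKernel κ] (c : ℝ≥0∞) (n : ℕ) :
    ergodicSum κ (fun _ => c) n = fun _ => n * c := by
  induction n with
  | zero => funext x; simp [ergodicSum]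
  | succ n ih =>
    funext x
    simp only [ergodicSum]
    rw [ih]
    simp [act]
    ring

lemma lintegral_ergodicSum (hinv : κ.Invariant ν) (hf : Measurable f) (n : ℕ) :
    ∫⁻ x, ergodicSum κ f n x ∂ν = n * ∫⁻ x, f x ∂ν := by
  induction n with
  | zero => simp [ergodicSum]
  | succ n ih =>
    simp only [ergodicSum]
    rw [lintegral_add_left hf, lintegral_act hinv (measurable_ergodicSum hf n), ih]
    push_cast
    ring

lemma ergodicSum_succ (hf : Measurable f) (n : ℕ) :
    ergodicSum κ f (n + 1) = fun x => ergodicSum κ f n x + (act κ)^[n] f x := by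
  induction n with
  | zero => funext x; simp [ergodicSum, act]
  | succ n ih =>
    funext x
    change f x + act κ (ergodicSum κ f (n + 1)) x = (f x + act κ (ergodicSum κ f n) x) + _
    rw [ih, act_add (measurable_ergodicSum hf n), Function.iterate_succ_apply', add_assoc]

lemma ergodicSum_of_act_eq (hinv : κ.Invariant ν)
    (h : act κ f =ᵐ[ν] f) (n : ℕ) : ergodicSum κ f n =ᵐ[ν] fun x => n * f x := by
  induction n with
  | zero => simp [ergodicSum]; rfl
  | succ n ih =>
    filter_upwards [act_congr_ae hinv ih, h] with x hx hx'
    change f x + act κ (ergodicSum κ f n) x = _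
    rw [hx]
    have : act κ (fun x => (n : ℝ≥0∞) * f x) x = n * act κ f x :=
      lintegral_const_mul' _ _ (ENNReal.natCast_ne_top n)
    rw [this, hx']
    push_cast
    ring

lemma measurable_hopfMax (ha : Measurable a) (hb : Measurable b) (n : ℕ) :
    Measurable (hopfMax κ a b n) := by
  induction n with
  | zero => exact measurable_zero
  | succ n ih => exact (ha.add (measurable_act ih)).sub hb

lemma hopfMax_mono (n : ℕ) : hopfMax κ a b n ≤ hopfMax κ a b (n + 1) := by
  induction n with
  | zero => exact fun x => zero_le
  | succ n ih =>
    intro x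
    exact tsub_le_tsub_right (add_le_add_right (act_mono ih x) _) _

lemma ergodicSum_le_add_hopfMax (hb : Measurable b) (n : ℕ) (x : S) :
    ergodicSum κ a n x ≤ ergodicSum κ b n x + hopfMax κ a b n x := by
  induction n generalizing x with
  | zero => simp [ergodicSum]
  | succ n ih =>
    have h1 : act κ (ergodicSum κ a n) x
        ≤ act κ (ergodicSum κ b n) x + act κ (hopfMax κ a b n) x := by
      have := act_mono (κ := κ) (f := ergodicSum κ a n) (fun x => ih x) x
      rwa [act_add (measurable_ergodicSum hb n)] at this
    have h2 : a x + act κ (hopfMax κ a b n) x ≤ hopfMax κ a b (n + 1) x + b x :=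
      le_tsub_add
    calc ergodicSum κ a (n + 1) x
        ≤ a x + (act κ (ergodicSum κ b n) x + act κ (hopfMax κ a b n) x) :=
          add_le_add_right h1 _
      _ = (a x + act κ (hopfMax κ a b n) x) + act κ (ergodicSum κ b n) x := by ring
      _ ≤ (hopfMax κ a b (n + 1) x + b x) + act κ (ergodicSum κ b n) x :=
          add_le_add_left h2 _
      _ = _ := by simp only [ergodicSum]; ring

lemma lintegral_hopfMax_ne_top (hinv : κ.Invariant ν) (ha : Measurable a) (hb : Measurable b)
    (hfin : ∫⁻ x, a x ∂ν ≠ ∞) (n : ℕ) : ∫⁻ x, hopfMax κ a b n x ∂ν ≠ ∞ := by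
  induction n with
  | zero => simp [hopfMax]
  | succ n ih =>
    refine ne_top_of_le_ne_top ?_ (lintegral_mono fun x => tsub_le_self)
    rw [lintegral_add_left ha, lintegral_act hinv (measurable_hopfMax ha hb n)]
    exact ENNReal.add_ne_top.2 ⟨hfin, ih⟩

/-- **Hopf's maximal ergodic lemma** for the difference `a - b`. -/
lemma hopf (hinv : κ.Invariant ν) (ha : Measurable a) (hb : Measurable b)
    (hfin : ∫⁻ x, a x ∂ν ≠ ∞) :
    ∫⁻ x in ⋃ n, {x | hopfMax κ a b n x ≠ 0}, b x ∂ν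
      ≤ ∫⁻ x in ⋃ n, {x | hopfMax κ a b n x ≠ 0}, a x ∂ν := by
  have hm : ∀ n, MeasurableSet {x | hopfMax κ a b n x ≠ 0} := fun n =>
    (measurableSet_eq_fun (measurable_hopfMax ha hb n) measurable_const).compl
  have hmono : Monotone fun n => {x | hopfMax κ a b n x ≠ 0} := by
    refine monotone_nat_of_le_succ fun n x hx => ?_
    exact (lt_of_lt_of_le (pos_iff_ne_zero.2 hx) (hopfMax_mono n x)).ne'
  rw [setLIntegral_iUnion_of_directed _ hmono.directed_le]
  refine iSup_le fun n => ?_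
  refine le_trans ?_ (lintegral_mono_set (Set.subset_iUnion _ n))
  cases n with
  | zero => simp [hopfMax]
  | succ n =>
    set E := {x | hopfMax κ a b (n + 1) x ≠ 0}
    set M := hopfMax κ a b (n + 1) with hM
    have hMm : Measurable M := measurable_hopfMax ha hb _
    have hMfin : ∫⁻ x, M x ∂ν ≠ ∞ := lintegral_hopfMax_ne_top hinv ha hb hfin _
    have h1 : ∫⁻ x in E, (M x + b x) ∂ν ≤ ∫⁻ x in E, (a x + act κ M x) ∂ν := by
      refine setLIntegral_mono (ha.add (measurable_act hMm)) fun x hx => ?_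
      have hpos : b x ≤ a x + act κ (hopfMax κ a b n) x := by
        by_contra hlt
        exact hx (tsub_eq_zero_of_le (not_le.1 hlt).le)
      have : M x + b x = a x + act κ (hopfMax κ a b n) x := tsub_add_cancel_of_le hpos
      rw [this]
      exact add_le_add_right (act_mono (hopfMax_mono n) x) _
    rw [lintegral_add_left hMm, lintegral_add_left ha] at h1
    have h2 : ∫⁻ x in E, M x ∂ν = ∫⁻ x, M x ∂ν := by
      rw [setLIntegral_eq_of_support_subset]
      exact fun x hx => hx
    have h3 : ∫⁻ x in E, act κ M x ∂ν ≤ ∫⁻ x, M x ∂ν :=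
      (setLIntegral_le_lintegral _ _).trans (lintegral_act hinv hMm).le
    rw [h2] at h1
    have h4 := h1.trans (add_le_add_right h3 _)
    rw [add_comm (∫⁻ x in E, a x ∂ν)] at h4
    exact (ENNReal.add_le_add_iff_left hMfin).1 h4

lemma lintegral_le_of_exists_ergodicSum_lt (hinv : κ.Invariant ν) (ha : Measurable a)
    (hb : Measurable b) (hfin : ∫⁻ x, a x ∂ν ≠ ∞)
    (h : ∀ᵐ x ∂ν, ∃ n, ergodicSum κ b n x < ergodicSum κ a n x) :
    ∫⁻ x, b x ∂ν ≤ ∫⁻ x, a x ∂ν := by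
  have hE : (⋃ n, {x | hopfMax κ a b n x ≠ 0}) =ᵐ[ν] Set.univ := by
    rw [eventuallyEq_univ]
    filter_upwards [h] with x ⟨n, hn⟩
    refine Set.mem_iUnion.2 ⟨n, fun h0 => ?_⟩
    have := ergodicSum_le_add_hopfMax (κ := κ) (a := a) hb n x
    rw [h0, add_zero] at this
    exact absurd hn this.not_gt
  have := hopf hinv ha hb hfin
  rwa [setLIntegral_congr hE, setLIntegral_congr hE, setLIntegral_univ,
    setLIntegral_univ] at this

lemma mul_measure_exists_lt_ergodicSum_le [IsMarkovKernel κ] (hinv : κ.Invariant ν)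
    (hf : Measurable f) (hfin : ∫⁻ x, f x ∂ν ≠ ∞) (c : ℝ≥0∞) :
    c * ν {x | ∃ n : ℕ, n * c < ergodicSum κ f n x} ≤ ∫⁻ x, f x ∂ν := by
  have h := hopf hinv hf (measurable_const (a := c)) hfin
  rw [setLIntegral_const] at h
  refine le_trans ?_ (h.trans (setLIntegral_le_lintegral _ _))
  gcongr
  rintro x ⟨n, hn⟩
  refine Set.mem_iUnion.2 ⟨n, fun h0 => ?_⟩
  have := ergodicSum_le_add_hopfMax (κ := κ) (a := f) (measurable_const (a := c)) n x
  rw [h0, add_zero, ergodicSum_const] at this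
  exact absurd hn this.not_gt

lemma measurable_liminf_ergodicSum (hf : Measurable f) :
    Measurable fun x => liminf (fun n : ℕ => ergodicSum κ f n x / n) atTop :=
  Measurable.liminf fun n => (measurable_ergodicSum hf n).div_const _

lemma lintegral_liminf_ergodicSum_le (hinv : κ.Invariant ν) (hf : Measurable f) :
    ∫⁻ x, liminf (fun n : ℕ => ergodicSum κ f n x / n) atTop ∂ν ≤ ∫⁻ x, f x ∂ν := by
  refine (lintegral_liminf_le fun n => (measurable_ergodicSum hf n).div_const _).trans ?_
  refine (liminf_le_liminf (v := fun _ => ∫⁻ x, f x ∂ν) (Eventually.of_forall fun n => ?_)).trans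
    (liminf_const _).le
  change ∫⁻ x, ergodicSum κ f n x / n ∂ν ≤ _
  simp only [div_eq_mul_inv]
  rw [lintegral_mul_const _ (measurable_ergodicSum hf n), lintegral_ergodicSum hinv hf,
    ← div_eq_mul_inv, mul_comm]
  exact ENNReal.div_le_of_le_mul le_rfl

lemma act_liminf_le (hf : Measurable f) (x : S) :
    act κ (fun x => liminf (fun n : ℕ => ergodicSum κ f n x / n) atTop) x
      ≤ liminf (fun n : ℕ => ergodicSum κ f n x / n) atTop := by
  have h1 : act κ (fun x => liminf (fun n : ℕ => ergodicSum κ f n x / n) atTop) x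
      ≤ liminf (fun n : ℕ => ergodicSum κ f (n + 1) x / n) atTop := by
    refine (lintegral_liminf_le fun n => (measurable_ergodicSum hf n).div_const _).trans ?_
    refine liminf_le_liminf (Eventually.of_forall fun n => ?_)
    change ∫⁻ y, ergodicSum κ f n y / n ∂κ x ≤ (f x + act κ (ergodicSum κ f n) x) / n
    simp only [div_eq_mul_inv]
    rw [lintegral_mul_const _ (measurable_ergodicSum hf n)]
    gcongr
    exact le_add_self
  refine h1.trans (le_of_forall_gt fun c hc => ?_)
  obtain ⟨d, hd, hdc⟩ := exists_between hc
  have hfreq : ∃ᶠ n : ℕ in atTop, ergodicSum κ f n x / n < d :=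
    frequently_lt_of_liminf_lt (by isBoundedDefault) hd
  obtain ⟨e, hde, hec⟩ := exists_between hdc
  refine lt_of_le_of_lt ?_ hec
  have hlim : Tendsto (fun n : ℕ => d * (((n : ℝ≥0∞) + 1) / n)) atTop (𝓝 (d * 1)) := by
    refine ENNReal.Tendsto.const_mul ?_ (Or.inl one_ne_zero)
    have h2 : Tendsto (fun n : ℕ => (1 : ℝ≥0∞) + (n : ℝ≥0∞)⁻¹) atTop (𝓝 (1 + 0)) :=
      tendsto_const_nhds.add ENNReal.tendsto_inv_nat_nhds_zero
    rw [add_zero] at h2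
    refine h2.congr' ?_
    filter_upwards [eventually_gt_atTop 0] with n hn
    rw [ENNReal.add_div, ENNReal.div_self (by exact_mod_cast hn.ne') (ENNReal.natCast_ne_top n),
      one_div]
  have hev : ∀ᶠ n : ℕ in atTop, d * (((n : ℝ≥0∞) + 1) / n) < e :=
    hlim.eventually_lt_const (by rwa [mul_one])
  refine liminf_le_of_frequently_le ?_ (by isBoundedDefault)
  have hfreq' : ∃ᶠ n : ℕ in atTop,
      ergodicSum κ f (n + 1) x / ((n + 1 : ℕ) : ℝ≥0∞) < d := by
    have := (frequently_atTop'.1 hfreq)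
    refine frequently_atTop.2 fun N => ?_
    obtain ⟨m, hm, hm'⟩ := this N
    refine ⟨m - 1, by omega, ?_⟩
    rwa [Nat.sub_add_cancel (by omega)]
  refine (hfreq'.and_eventually hev).mono fun n hn => ?_
  obtain ⟨hn1, hn2⟩ := hn
  refine le_trans ?_ hn2.le
  rw [← mul_div_assoc]
  gcongr
  have h3 := (ENNReal.div_le_iff (by simp) (by simp)).1 hn1.le
  rwa [Nat.cast_succ] at h3

/-- The lower ergodic limit of an integrable function has the same integral. -/
lemma lintegral_liminf_ergodicSum [IsProbabilityMeasure ν] [IsMarkovKernel κ]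
    (hinv : κ.Invariant ν) (hf : Measurable f) (hfin : ∫⁻ x, f x ∂ν ≠ ∞) :
    ∫⁻ x, liminf (fun n : ℕ => ergodicSum κ f n x / n) atTop ∂ν = ∫⁻ x, f x ∂ν := by
  set F : S → ℝ≥0∞ := fun x => liminf (fun n : ℕ => ergodicSum κ f n x / n) atTop with hF
  have hFm : Measurable F := measurable_liminf_ergodicSum hf
  have hFle : ∫⁻ x, F x ∂ν ≤ ∫⁻ x, f x ∂ν := lintegral_liminf_ergodicSum_le hinv hf
  have hFfin : ∫⁻ x, F x ∂ν ≠ ∞ := ne_top_of_le_ne_top hfin hFle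
  refine le_antisymm hFle ?_
  have hFT : act κ F =ᵐ[ν] F :=
    ae_eq_of_ae_le_of_lintegral_le (Eventually.of_forall fun x => act_liminf_le hf x)
      (by rwa [lintegral_act hinv hFm]) hFm.aemeasurable (lintegral_act hinv hFm).ge
  refine ENNReal.le_of_forall_pos_le_add fun ε hε _ => ?_
  have hsum : ∫⁻ x, (F x + ε) ∂ν = ∫⁻ x, F x ∂ν + ε := by
    rw [lintegral_add_left hFm]
    simp
  rw [← hsum]
  refine lintegral_le_of_exists_ergodicSum_lt hinv (hFm.add_const _) hf
    (by rw [hsum]; exact ENNReal.add_ne_top.2 ⟨hFfin, ENNReal.coe_ne_top⟩) ?_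
  filter_upwards [ae_all_iff.2 (ergodicSum_of_act_eq hinv hFT), ae_lt_top hFm hFfin]
    with x hx hxfin
  have hlt : F x < F x + ε :=
    ENNReal.lt_add_right hxfin.ne (ENNReal.coe_ne_zero.2 hε.ne')
  have hfreq : ∃ᶠ n : ℕ in atTop, ergodicSum κ f n x / n < F x + ε :=
    frequently_lt_of_liminf_lt (by isBoundedDefault) hlt
  obtain ⟨n, hn, hn0⟩ := (hfreq.and_eventually (eventually_gt_atTop 0)).exists
  refine ⟨n, ?_⟩
  have h0 : (n : ℝ≥0∞) ≠ 0 := by exact_mod_cast hn0.ne'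
  rw [ENNReal.div_lt_iff (Or.inl h0) (Or.inl (ENNReal.natCast_ne_top n))] at hn
  refine hn.trans_le ?_
  rw [ergodicSum_add hFm]
  beta_reduce
  rw [hx n, ergodicSum_const, add_mul, mul_comm, mul_comm (ε : ℝ≥0∞)]

lemma limsup_le_liminf_of_bounded [IsProbabilityMeasure ν] [IsMarkovKernel κ]
    (hinv : κ.Invariant ν) (hf : Measurable f) (K : NNReal) (hK : ∀ x, f x ≤ K) :
    ∀ᵐ x ∂ν, limsup (fun n : ℕ => ergodicSum κ f n x / n) atTop
      ≤ liminf (fun n : ℕ => ergodicSum κ f n x / n) atTop := by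
  set g : S → ℝ≥0∞ := fun x => K - f x with hg
  have hgm : Measurable g := measurable_const.sub hf
  have hfg : ∀ n x, ergodicSum κ f n x + ergodicSum κ g n x = n * K := by
    intro n x
    have h1 := ergodicSum_add (κ := κ) (g := g) hf n
    have h2 : (fun x => f x + g x) = fun _ => (K : ℝ≥0∞) := by
      funext x
      exact add_tsub_cancel_of_le (hK x)
    rw [h2, ergodicSum_const] at h1
    exact (congrFun h1 x).symm
  have hfin : ∫⁻ x, f x ∂ν ≠ ∞ := by
    refine ne_top_of_le_ne_top ?_ (lintegral_mono hK)
    simp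
  have hgfin : ∫⁻ x, g x ∂ν ≠ ∞ := by
    refine ne_top_of_le_ne_top ?_ (lintegral_mono fun x => (tsub_le_self : g x ≤ K))
    simp
  set F : S → ℝ≥0∞ := fun x => liminf (fun n : ℕ => ergodicSum κ f n x / n) atTop with hF
  set G : S → ℝ≥0∞ := fun x => liminf (fun n : ℕ => ergodicSum κ g n x / n) atTop with hG
  have hGm : Measurable G := measurable_liminf_ergodicSum hgm
  have hFm : Measurable F := measurable_liminf_ergodicSum hf
  have hGfin : ∫⁻ x, G x ∂ν ≠ ∞ :=
    ne_top_of_le_ne_top hgfin (lintegral_liminf_ergodicSum_le hinv hgm)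
  have key : ∀ x, limsup (fun n : ℕ => ergodicSum κ f n x / n) atTop + G x ≤ K := by
    intro x
    have : ∀ᶠ n : ℕ in atTop, ergodicSum κ f n x / n = K - ergodicSum κ g n x / n := by
      filter_upwards [eventually_gt_atTop 0] with n hn
      have h0 : (n : ℝ≥0∞) ≠ 0 := by exact_mod_cast hn.ne'
      have h1 : ergodicSum κ f n x / n + ergodicSum κ g n x / n = K := by
        rw [← ENNReal.add_div, hfg, mul_comm,
          ENNReal.mul_div_cancel_right h0 (ENNReal.natCast_ne_top n)]
      refine ENNReal.eq_sub_of_add_eq ?_ h1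
      exact ne_top_of_le_ne_top ENNReal.coe_ne_top (h1 ▸ le_add_self)
    rw [limsup_congr this, ENNReal.limsup_const_sub _ _ ENNReal.coe_ne_top]
    refine (tsub_add_cancel_of_le ?_).le
    refine (liminf_le_liminf (v := fun _ => (K : ℝ≥0∞)) ?_).trans (liminf_const _).le
    filter_upwards [eventually_gt_atTop 0] with n hn
    refine ENNReal.div_le_of_le_mul ?_
    rw [mul_comm, ← hfg n x]
    exact le_add_self
  have hFG : ∀ᵐ x ∂ν, F x + G x = K := by
    refine ae_eq_of_ae_le_of_lintegral_le (Eventually.of_forall fun x => ?_) ?_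
      measurable_const.aemeasurable ?_
    · exact (add_le_add_left (liminf_le_limsup) _).trans (key x)
    · rw [lintegral_add_left hFm]
      exact ENNReal.add_ne_top.2
        ⟨ne_top_of_le_ne_top hfin (lintegral_liminf_ergodicSum_le hinv hf), hGfin⟩
    · rw [lintegral_add_left hFm, lintegral_liminf_ergodicSum hinv hf hfin,
        lintegral_liminf_ergodicSum hinv hgm hgfin, ← lintegral_add_left hf]
      exact lintegral_mono fun x => (add_tsub_cancel_of_le (hK x)).ge
  filter_upwards [hFG, ae_lt_top hGm hGfin] with x hx hx'
  exact (ENNReal.add_le_add_iff_right hx'.ne).1 ((key x).trans hx.ge)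

/-- **Pointwise ergodic theorem** for a Markov kernel with an invariant probability measure. -/
theorem exists_tendsto_ergodicSum [IsProbabilityMeasure ν] [IsMarkovKernel κ]
    (hinv : κ.Invariant ν) (hf : Measurable f) (hfin : ∫⁻ x, f x ∂ν ≠ ∞) :
    ∃ F : S → ℝ≥0∞, Measurable F ∧ ∫⁻ x, F x ∂ν = ∫⁻ x, f x ∂ν ∧
      ∀ᵐ x ∂ν, Tendsto (fun n : ℕ => ergodicSum κ f n x / n) atTop (𝓝 (F x)) := by
  set F : S → ℝ≥0∞ := fun x => liminf (fun n : ℕ => ergodicSum κ f n x / n) atTop with hF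
  refine ⟨F, measurable_liminf_ergodicSum hf, lintegral_liminf_ergodicSum hinv hf hfin, ?_⟩
  suffices h : ∀ᵐ x ∂ν, limsup (fun n : ℕ => ergodicSum κ f n x / n) atTop ≤ F x by
    filter_upwards [h] with x hx
    exact tendsto_of_le_liminf_of_limsup_le le_rfl hx
  set L : S → ℝ≥0∞ := fun x => limsup (fun n : ℕ => ergodicSum κ f n x / n) atTop with hL
  have htail : Tendsto (fun K : ℕ => ∫⁻ x, (f x - min (f x) K) ∂ν) atTop (𝓝 0) := by
    have : Tendsto (fun K : ℕ => ∫⁻ x, (f x - min (f x) K) ∂ν) atTop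
        (𝓝 (∫⁻ _, 0 ∂ν)) := by
      refine tendsto_lintegral_of_dominated_convergence f
        (fun K => hf.sub (hf.min measurable_const))
        (fun K => Eventually.of_forall fun x => tsub_le_self) hfin ?_
      filter_upwards [ae_lt_top hf hfin] with x hx
      obtain ⟨m, hm⟩ := ENNReal.exists_nat_gt hx.ne
      refine tendsto_const_nhds.congr' ?_
      filter_upwards [eventually_ge_atTop m] with K hK
      rw [min_eq_left (hm.le.trans (by exact_mod_cast hK)), tsub_self]
    simpa using this
  have hbad : ∀ m : ℕ, ν {x | ¬ L x ≤ F x + ((m : ℝ≥0∞) + 1)⁻¹} = 0 := by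
    intro m
    set c : ℝ≥0∞ := ((m : ℝ≥0∞) + 1)⁻¹ with hc
    have hc0 : c ≠ 0 := by simp [hc]
    have hle : ∀ K : ℕ, c * ν {x | ¬ L x ≤ F x + c} ≤ ∫⁻ x, (f x - min (f x) K) ∂ν := by
      intro K
      have hkm : Measurable fun x => min (f x) (K : ℝ≥0∞) := hf.min measurable_const
      have hrm : Measurable fun x => f x - min (f x) (K : ℝ≥0∞) := hf.sub hkm
      refine le_trans ?_ (mul_measure_exists_lt_ergodicSum_le (κ := κ) hinv hrm
        (ne_top_of_le_ne_top hfin (lintegral_mono fun x => tsub_le_self)) c)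
      refine mul_le_mul_right (measure_mono_ae ?_) _
      filter_upwards [limsup_le_liminf_of_bounded (κ := κ) hinv hkm K
        (fun x => min_le_right _ _)] with x hx hx'
      by_contra hcon
      refine hx' ?_
      replace hcon : ∀ n : ℕ, ergodicSum κ (fun x => f x - min (f x) (K : ℝ≥0∞)) n x
          ≤ n * c := fun n => not_lt.1 fun hlt => hcon ⟨n, hlt⟩
      have hsplit : ∀ n, ergodicSum κ f n x = ergodicSum κ (fun x => min (f x) (K : ℝ≥0∞)) n x
          + ergodicSum κ (fun x => f x - min (f x) (K : ℝ≥0∞)) n x := by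
        intro n
        have h1 := ergodicSum_add (κ := κ) (g := fun x => f x - min (f x) (K : ℝ≥0∞)) hkm n
        have h2 : (fun x => min (f x) (K : ℝ≥0∞) + (f x - min (f x) (K : ℝ≥0∞))) = f := by
          funext x
          exact add_tsub_cancel_of_le (min_le_left _ _)
        rw [h2] at h1
        exact congrFun h1 x
      calc L x ≤ limsup (fun n : ℕ =>
            ergodicSum κ (fun x => min (f x) (K : ℝ≥0∞)) n x / n + c) atTop := by
            refine limsup_le_limsup ?_
            filter_upwards [eventually_gt_atTop 0] with n hn
            have h0 : (n : ℝ≥0∞) ≠ 0 := by exact_mod_cast hn.ne'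
            rw [hsplit, ENNReal.add_div]
            gcongr
            refine ENNReal.div_le_of_le_mul ?_
            rw [mul_comm]
            exact hcon n
        _ ≤ limsup (fun n : ℕ =>
            ergodicSum κ (fun x => min (f x) (K : ℝ≥0∞)) n x / n) atTop + c := by
            exact (limsup_add_const atTop _ c (by isBoundedDefault) (by isBoundedDefault)).le
        _ ≤ liminf (fun n : ℕ =>
            ergodicSum κ (fun x => min (f x) (K : ℝ≥0∞)) n x / n) atTop + c := by
            gcongr
        _ ≤ F x + c := by
            gcongr
            refine liminf_le_liminf (Eventually.of_forall fun n => ?_)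
            rw [hsplit]
            gcongr
            exact le_self_add
    have h0 : c * ν {x | ¬ L x ≤ F x + c} ≤ 0 := ge_of_tendsto' htail hle
    exact (mul_eq_zero.1 (nonpos_iff_eq_zero.1 h0)).resolve_left hc0
  filter_upwards [ae_all_iff.2 fun m => (ae_iff.2 (hbad m))] with x hx
  have hlim : Tendsto (fun m : ℕ => F x + ((m : ℝ≥0∞) + 1)⁻¹) atTop (𝓝 (F x + 0)) := by
    refine tendsto_const_nhds.add ?_
    have := (tendsto_add_atTop_iff_nat 1).2 ENNReal.tendsto_inv_nat_nhds_zero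
    refine this.congr fun m => ?_
    push_cast
    rfl
  rw [add_zero] at hlim
  exact ge_of_tendsto' hlim hx

lemma ergodicSum_mono_ae (hinv : κ.Invariant ν) (h : f ≤ᵐ[ν] g) (n : ℕ) :
    ergodicSum κ f n ≤ᵐ[ν] ergodicSum κ g n := by
  induction n with
  | zero => exact EventuallyLE.rfl
  | succ n ih =>
    filter_upwards [act_mono_ae hinv ih, h] with x hx hx'
    exact add_le_add hx' hx

lemma tendsto_iterate_act_div [IsProbabilityMeasure ν] [IsMarkovKernel κ]
    (hinv : κ.Invariant ν) (hf : Measurable f) (hfin : ∫⁻ x, f x ∂ν ≠ ∞) :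
    ∀ᵐ x ∂ν, Tendsto (fun n : ℕ => (act κ)^[n] f x / n) atTop (𝓝 0) := by
  obtain ⟨F, hFm, hF, hlim⟩ := exists_tendsto_ergodicSum hinv hf hfin
  filter_upwards [hlim, ae_lt_top hFm (hF ▸ hfin)] with x hx hxfin
  have h1 : Tendsto (fun n : ℕ => ergodicSum κ f (n + 1) x / ((n + 1 : ℕ) : ℝ≥0∞)
      * (1 + (n : ℝ≥0∞)⁻¹)) atTop (𝓝 (F x * 1)) := by
    refine ENNReal.Tendsto.mul ((tendsto_add_atTop_iff_nat 1).2 hx) (Or.inr ENNReal.one_ne_top)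
      ?_ (Or.inr hxfin.ne)
    have h2 : Tendsto (fun n : ℕ => (1 : ℝ≥0∞) + (n : ℝ≥0∞)⁻¹) atTop (𝓝 (1 + 0)) :=
      tendsto_const_nhds.add ENNReal.tendsto_inv_nat_nhds_zero
    rwa [add_zero] at h2
  have h3 := ENNReal.Tendsto.sub h1 hx (Or.inr hxfin.ne)
  rw [mul_one, tsub_self] at h3
  refine h3.congr' ?_
  have hfinx : ∀ᶠ n : ℕ in atTop, ergodicSum κ f n x / n < ∞ := hx.eventually_lt_const hxfin
  filter_upwards [eventually_gt_atTop 0, hfinx] with n hn hn'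
  have h0 : (n : ℝ≥0∞) ≠ 0 := by exact_mod_cast hn.ne'
  have e1 : ergodicSum κ f (n + 1) x / ((n + 1 : ℕ) : ℝ≥0∞) * (1 + (n : ℝ≥0∞)⁻¹)
      = ergodicSum κ f (n + 1) x / n := by
    have : (1 : ℝ≥0∞) + (n : ℝ≥0∞)⁻¹ = ((n + 1 : ℕ) : ℝ≥0∞) / n := by
      rw [Nat.cast_succ, ENNReal.add_div, ENNReal.div_self h0 (ENNReal.natCast_ne_top n), one_div]
    rw [this, ← mul_div_assoc,
      ENNReal.div_mul_cancel (by simp) (ENNReal.natCast_ne_top _)]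
  rw [e1, ergodicSum_succ hf, ENNReal.add_div, ENNReal.add_sub_cancel_left hn'.ne]

/-- A subadditive ergodic theorem for Markov kernels: if `H (n + 1) = D n + T (H n)`
with nonincreasing increments `D`, then `H n / n` converges almost surely and in mean. -/
theorem exists_tendsto_of_antitone_increments [IsProbabilityMeasure ν] [IsMarkovKernel κ]
    (hinv : κ.Invariant ν) {H D : ℕ → S → ℝ≥0∞} (hHm : ∀ n, Measurable (H n))
    (hDm : ∀ n, Measurable (D n)) (hH0 : H 0 =ᵐ[ν] 0)
    (hHD : ∀ n, H (n + 1) =ᵐ[ν] fun x => D n x + act κ (H n) x)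
    (hanti : ∀ n, D (n + 1) ≤ᵐ[ν] D n) (hfin : ∫⁻ x, D 0 x ∂ν ≠ ∞) :
    ∃ h : S → ℝ≥0∞, Measurable h ∧ ∫⁻ x, h x ∂ν ≠ ∞ ∧
      (∀ n, ∫⁻ x, H n x ∂ν ≠ ∞) ∧
      (∀ᵐ x ∂ν, Tendsto (fun n : ℕ => H n x / n) atTop (𝓝 (h x))) ∧
      Tendsto (fun n : ℕ => (∫⁻ x, H n x ∂ν) / n) atTop (𝓝 (∫⁻ x, h x ∂ν)) := by
  have hanti' : ∀ᵐ x ∂ν, Antitone fun n => D n x := by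
    filter_upwards [ae_all_iff.2 hanti] with x hx
    exact antitone_nat_of_succ_le hx
  have hDfin : ∀ n, ∫⁻ x, D n x ∂ν ≠ ∞ := fun n => by
    refine ne_top_of_le_ne_top hfin (lintegral_mono_ae ?_)
    filter_upwards [hanti'] with x hx
    exact hx (Nat.zero_le n)
  have hHint : ∀ n, ∫⁻ x, H (n + 1) x ∂ν = ∫⁻ x, D n x ∂ν + ∫⁻ x, H n x ∂ν := fun n => by
    rw [lintegral_congr_ae (hHD n), lintegral_add_left (hDm n), lintegral_act hinv (hHm n)]
  have hHfin : ∀ n, ∫⁻ x, H n x ∂ν ≠ ∞ := fun n => by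
    induction n with
    | zero => rw [lintegral_congr_ae hH0]; simp
    | succ n ih =>
      rw [hHint]
      exact ENNReal.add_ne_top.2 ⟨hDfin n, ih⟩
  set E : S → ℝ≥0∞ := fun x => ⨅ n, D n x with hE
  have hEm : Measurable E := Measurable.iInf hDm
  have hEle : ∀ k, E ≤ᵐ[ν] D k := fun k => Eventually.of_forall fun x => iInf_le _ k
  have hEfin : ∫⁻ x, E x ∂ν ≠ ∞ := ne_top_of_le_ne_top hfin (lintegral_mono_ae (hEle 0))
  have hEint : ∫⁻ x, E x ∂ν = ⨅ n, ∫⁻ x, D n x ∂ν := lintegral_iInf_ae hDm hanti hfin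
  have hlow : ∀ n, ergodicSum κ E n ≤ᵐ[ν] H n := fun n => by
    induction n with
    | zero => exact Eventually.of_forall fun x => zero_le
    | succ n ih =>
      filter_upwards [act_mono_ae hinv ih, hHD n, hEle n] with x h1 h2 h3
      rw [h2]
      exact add_le_add h3 h1
  have hup : ∀ k n, H (n + k) ≤ᵐ[ν]
      fun x => ergodicSum κ (D k) n x + (act κ)^[n] (H k) x := fun k n => by
    induction n with
    | zero => simp only [zero_add]; exact Eventually.of_forall fun x => le_add_self
    | succ n ih =>
      have h0 := hHD (n + k)
      rw [show n + k + 1 = n + 1 + k by ring] at h0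
      filter_upwards [act_mono_ae hinv ih, h0, hanti'] with x h1 h2 h3
      rw [h2, Function.iterate_succ_apply']
      rw [act_add (measurable_ergodicSum (hDm k) n)] at h1
      change _ ≤ (D k x + act κ (ergodicSum κ (D k) n) x) + _
      rw [add_assoc]
      exact add_le_add (h3 (Nat.le_add_left k n)) h1
  obtain ⟨h, hhm, hhint, hhlim⟩ := exists_tendsto_ergodicSum hinv hEm hEfin
  choose F hFm hFint hFlim using fun k => exists_tendsto_ergodicSum hinv (hDm k) (hDfin k)
  have hhF : ∀ k, h ≤ᵐ[ν] F k := fun k => by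
    filter_upwards [hhlim, hFlim k, ae_all_iff.2 fun n => ergodicSum_mono_ae hinv (hEle k) n]
      with x h1 h2 h3
    refine le_of_tendsto_of_tendsto' h1 h2 fun n => ?_
    gcongr
    exact h3 n
  have hinf : h =ᵐ[ν] fun x => ⨅ k, F k x := by
    refine ae_eq_of_ae_le_of_lintegral_le ?_ (hhint ▸ hEfin)
      (Measurable.iInf hFm).aemeasurable ?_
    · filter_upwards [ae_all_iff.2 hhF] with x hx
      exact le_iInf hx
    · rw [hhint, hEint]
      refine le_iInf fun k => ?_
      rw [← hFint k]
      exact lintegral_mono fun x => iInf_le _ k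
  refine ⟨h, hhm, hhint ▸ hEfin, hHfin, ?_, ?_⟩
  · filter_upwards [hinf, hhlim, ae_all_iff.2 hFlim, ae_all_iff.2 hlow,
      ae_all_iff.2 fun k => ae_all_iff.2 (hup k),
      ae_all_iff.2 fun k => tendsto_iterate_act_div hinv (hHm k) (hHfin k)]
      with x h1 h2 h3 h4 h5 h6
    refine tendsto_of_le_liminf_of_limsup_le ?_ ?_
    · rw [← h2.liminf_eq]
      refine liminf_le_liminf (Eventually.of_forall fun n => ?_)
      gcongr
      exact h4 n
    · rw [h1]
      refine le_iInf fun k => ?_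
      rw [← limsup_nat_add _ k]
      have := (h3 k).add (h6 k)
      rw [add_zero] at this
      rw [← this.limsup_eq]
      refine limsup_le_limsup (Eventually.of_forall fun n => ?_)
      beta_reduce
      rw [← ENNReal.add_div]
      refine ENNReal.div_le_div (h5 k n) ?_
      exact_mod_cast Nat.le_add_right n k
  · have hDlim : Tendsto (fun n => (∫⁻ x, D n x ∂ν).toReal) atTop (𝓝 (∫⁻ x, h x ∂ν).toReal) := by
      refine (ENNReal.tendsto_toReal_iff hDfin (hhint ▸ hEfin)).2 ?_
      rw [hhint, hEint]
      refine tendsto_atTop_iInf (antitone_nat_of_succ_le fun n => lintegral_mono_ae (hanti n))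
    have hsum : ∀ n, (∫⁻ x, H n x ∂ν).toReal
        = ∑ i ∈ Finset.range n, (∫⁻ x, D i x ∂ν).toReal := fun n => by
      induction n with
      | zero => rw [lintegral_congr_ae hH0]; simp
      | succ n ih =>
        rw [hHint, ENNReal.toReal_add (hDfin n) (hHfin n), ih, Finset.sum_range_succ, add_comm]
    have hces := hDlim.cesaro
    have : Tendsto (fun n : ℕ => ENNReal.ofReal
        ((n : ℝ)⁻¹ * ∑ i ∈ Finset.range n, (∫⁻ x, D i x ∂ν).toReal)) atTop
        (𝓝 (∫⁻ x, h x ∂ν)) := by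
      have := ENNReal.tendsto_ofReal hces
      rwa [ENNReal.ofReal_toReal (hhint ▸ hEfin)] at this
    refine this.congr' ?_
    filter_upwards [eventually_gt_atTop 0] with n hn
    rw [← hsum, ENNReal.ofReal_mul (by positivity), ENNReal.ofReal_toReal (hHfin n),
      ENNReal.ofReal_inv_of_pos (by exact_mod_cast hn), ENNReal.ofReal_natCast, mul_comm,
      div_eq_mul_inv]

end MarkovErgodic

namespace FiniteEntropy

variable {ι κ θ : Type*}

/-- The log-sum inequality, for the measures `a k` and `b k`. -/
lemma log_sum_le (s : Finset ι) {a b k : ι → ℝ} (ha : ∀ i, 0 ≤ a i) (hb : ∀ i, 0 ≤ b i)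
    (hk : ∀ i, 0 ≤ k i) (hab : ∀ i, 0 < a i → 0 < b i) :
    (∑ i ∈ s, a i * k i) * (Real.log (∑ i ∈ s, a i * k i) - Real.log (∑ i ∈ s, b i * k i))
      ≤ ∑ i ∈ s, a i * k i * (Real.log (a i) - Real.log (b i)) := by
  set A := ∑ i ∈ s, a i * k i with hA
  set B := ∑ i ∈ s, b i * k i with hB
  have hA0 : 0 ≤ A := Finset.sum_nonneg fun i _ => mul_nonneg (ha i) (hk i)
  rcases hA0.eq_or_lt with h0 | hApos
  · have hz : ∀ i ∈ s, a i * k i = 0 :=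
      (Finset.sum_eq_zero_iff_of_nonneg fun i _ => mul_nonneg (ha i) (hk i)).1 h0.symm
    rw [← h0, zero_mul, Finset.sum_eq_zero fun i hi => by rw [hz i hi, zero_mul]]
  have hBpos : 0 < B := by
    obtain ⟨i, hi, hne⟩ := Finset.exists_ne_zero_of_sum_ne_zero hApos.ne'
    have hai : 0 < a i := lt_of_le_of_ne (ha i) fun h => hne (by rw [← h, zero_mul])
    have hki : 0 < k i := lt_of_le_of_ne (hk i) fun h => hne (by rw [← h, mul_zero])
    exact Finset.sum_pos' (fun j _ => mul_nonneg (hb j) (hk j))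
      ⟨i, hi, mul_pos (hab i hai) hki⟩
  have hterm : ∀ i ∈ s, a i * k i * (Real.log A - Real.log B)
      ≤ a i * k i * (Real.log (a i) - Real.log (b i)) + (A / B * (b i * k i) - a i * k i) := by
    intro i _
    rcases (ha i).eq_or_lt with h0 | hai
    · rw [← h0]
      have : 0 ≤ A / B * (b i * k i) :=
        mul_nonneg (div_pos hApos hBpos).le (mul_nonneg (hb i) (hk i))
      linarith
    have hbi := hab i hai
    have hlog : Real.log (A * b i / (B * a i)) ≤ A * b i / (B * a i) - 1 :=
      Real.log_le_sub_one_of_pos (by positivity)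
    rw [Real.log_div (by positivity) (by positivity), Real.log_mul hApos.ne' hbi.ne',
      Real.log_mul hBpos.ne' hai.ne'] at hlog
    have := mul_le_mul_of_nonneg_left hlog (mul_nonneg hai.le (hk i))
    have e : a i * k i * (A * b i / (B * a i) - 1) = A / B * (b i * k i) - a i * k i := by
      field_simp
    rw [e] at this
    nlinarith [this]
  have hsum := Finset.sum_le_sum hterm
  rw [← Finset.sum_mul, Finset.sum_add_distrib, Finset.sum_sub_distrib, ← Finset.mul_sum,
    ← hA, ← hB, div_mul_cancel₀ _ hBpos.ne', sub_self, add_zero] at hsum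
  exact hsum

/-- Relative entropy does not increase under a stochastic kernel. -/
lemma relative_entropy_le (s : Finset ι) (t : Finset κ) {a b : ι → ℝ} {k : ι → κ → ℝ}
    (ha : ∀ i, 0 ≤ a i) (hb : ∀ i, 0 ≤ b i) (hk : ∀ i j, 0 ≤ k i j)
    (hab : ∀ i, 0 < a i → 0 < b i) (hk1 : ∀ i ∈ s, ∑ j ∈ t, k i j = 1) :
    ∑ j ∈ t, (∑ i ∈ s, a i * k i j)
        * (Real.log (∑ i ∈ s, a i * k i j) - Real.log (∑ i ∈ s, b i * k i j))
      ≤ ∑ i ∈ s, a i * (Real.log (a i) - Real.log (b i)) := by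
  refine (Finset.sum_le_sum fun j _ => log_sum_le s ha hb (fun i => hk i j) hab).trans_eq ?_
  rw [Finset.sum_comm]
  refine Finset.sum_congr rfl fun i hi => ?_
  rw [← Finset.sum_mul, ← Finset.mul_sum, hk1 i hi, mul_one]

/-- The entropy of a mixture minus the mean entropy of its components, as a mean relative
entropy. -/
lemma entropy_sub_eq (s : Finset ι) (t : Finset κ) (p : ι → ℝ) (q : ι → κ → ℝ) :
    ∑ j ∈ t, Real.negMulLog (∑ i ∈ s, p i * q i j)
        - ∑ i ∈ s, p i * ∑ j ∈ t, Real.negMulLog (q i j)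
      = ∑ i ∈ s, p i * ∑ j ∈ t, q i j *
          (Real.log (q i j) - Real.log (∑ i ∈ s, p i * q i j)) := by
  have h1 : ∑ j ∈ t, Real.negMulLog (∑ i ∈ s, p i * q i j)
      = ∑ i ∈ s, p i * ∑ j ∈ t, -(q i j * Real.log (∑ i ∈ s, p i * q i j)) := by
    simp_rw [Finset.mul_sum]
    rw [Finset.sum_comm]
    refine Finset.sum_congr rfl fun j _ => ?_
    rw [Real.negMulLog, ← Finset.sum_neg_distrib, Finset.sum_mul]
    exact Finset.sum_congr rfl fun i _ => by ring
  rw [h1, ← Finset.sum_sub_distrib]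
  refine Finset.sum_congr rfl fun i _ => ?_
  rw [← mul_sub, ← Finset.sum_sub_distrib]
  congr 1
  refine Finset.sum_congr rfl fun j _ => ?_
  rw [Real.negMulLog]
  ring

/-- Conditioning does not increase entropy. -/
lemma mean_entropy_le (s : Finset ι) (t : Finset κ) {p : ι → ℝ} {q : ι → κ → ℝ}
    (hp : ∀ i, 0 ≤ p i) (hp1 : ∑ i ∈ s, p i = 1) (hq : ∀ i j, 0 ≤ q i j) :
    ∑ i ∈ s, p i * ∑ j ∈ t, Real.negMulLog (q i j)
      ≤ ∑ j ∈ t, Real.negMulLog (∑ i ∈ s, p i * q i j) := by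
  simp_rw [Finset.mul_sum]
  rw [Finset.sum_comm]
  refine Finset.sum_le_sum fun j _ => ?_
  have := Real.concaveOn_negMulLog.le_map_sum (t := s) (w := p) (p := fun i => q i j)
    (fun i _ => hp i) hp1 (fun i _ => hq i j)
  simpa only [smul_eq_mul] using this

/-- The data processing inequality for mutual information. -/
lemma entropy_sub_le (s : Finset ι) (t : Finset κ) (v : Finset θ) {p : ι → ℝ}
    {q : ι → κ → ℝ} {k : κ → θ → ℝ} (hp : ∀ i, 0 ≤ p i) (hq : ∀ i j, 0 ≤ q i j)
    (hk : ∀ j l, 0 ≤ k j l) (hk1 : ∀ j ∈ t, ∑ l ∈ v, k j l = 1) :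
    ∑ l ∈ v, Real.negMulLog (∑ i ∈ s, p i * ∑ j ∈ t, q i j * k j l)
        - ∑ i ∈ s, p i * ∑ l ∈ v, Real.negMulLog (∑ j ∈ t, q i j * k j l)
      ≤ ∑ j ∈ t, Real.negMulLog (∑ i ∈ s, p i * q i j)
        - ∑ i ∈ s, p i * ∑ j ∈ t, Real.negMulLog (q i j) := by
  rw [entropy_sub_eq, entropy_sub_eq]
  refine Finset.sum_le_sum fun i hi => ?_
  rcases (hp i).eq_or_lt with h0 | hpi
  · rw [← h0, zero_mul, zero_mul]
  refine mul_le_mul_of_nonneg_left ?_ hpi.le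
  have hmix : ∀ l, ∑ i ∈ s, p i * ∑ j ∈ t, q i j * k j l
      = ∑ j ∈ t, (∑ i ∈ s, p i * q i j) * k j l := by
    intro l
    simp_rw [Finset.mul_sum, Finset.sum_mul]
    rw [Finset.sum_comm]
    exact Finset.sum_congr rfl fun _ _ => Finset.sum_congr rfl fun _ _ => by ring
  simp_rw [hmix]
  refine relative_entropy_le t v (hq i) (fun j => Finset.sum_nonneg fun i _ =>
    mul_nonneg (hp i) (hq i j)) hk (fun j hj => ?_) hk1
  exact Finset.sum_pos' (fun i _ => mul_nonneg (hp i) (hq i j)) ⟨i, hi, mul_pos hpi hj⟩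

end FiniteEntropy

namespace LazyWalk

/-- The degree of a vertex, as an extended nonnegative real. -/
noncomputable def extDeg (A : Env) (x : ℕ) : ℝ≥0∞ := ∑' y, if A x y = true then 1 else 0

/-- One-step transition probabilities, as extended nonnegative reals. -/
noncomputable def step (A : Env) (x y : ℕ) : ℝ≥0∞ := ENNReal.ofReal (ekernel A x y)

/-- Transition probabilities, as extended nonnegative reals. -/
noncomputable def stepPow (A : Env) : ℕ → ℕ → ℕ → ℝ≥0∞
  | 0 => fun x y => if x = y then 1 else 0
  | t + 1 => fun x y => ∑' u, stepPow A t x u * step A u y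

/-- Graphs without loops in which all degrees are finite and positive. -/
def Good (A : Env) : Prop :=
  ∀ x, A x x = false ∧ {y | A x y = true}.Finite ∧ 0 < edeg A x

variable {A : Env}

lemma extDeg_eq (A : Env) (x : ℕ) : extDeg A x = {y | A x y = true}.encard := by
  rw [← ENNReal.tsum_set_one, tsum_subtype {y | A x y = true} fun _ => (1 : ℝ≥0∞)]
  refine tsum_congr fun y => ?_
  simp [Set.indicator]

lemma edeg_eq (A : Env) (x : ℕ) : (edeg A x : ℝ) = (extDeg A x).toReal := by
  rw [extDeg_eq, edeg]
  rcases Set.finite_or_infinite {y | A x y = true} with h | h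
  · rw [← h.cast_ncard_eq]
    simp
  · rw [h.ncard, h.encard_eq]
    simp

lemma ekernel_nonneg (A : Env) (x y : ℕ) : 0 ≤ ekernel A x y := by
  unfold ekernel
  split_ifs <;> positivity

lemma step_ne_top (A : Env) (x y : ℕ) : step A x y ≠ ∞ := ENNReal.ofReal_ne_top

lemma measurable_apply (x y : ℕ) : Measurable fun A : Env => A x y :=
  (measurable_pi_apply y).comp (measurable_pi_apply x)

lemma measurableSet_adj (x y : ℕ) : MeasurableSet {A : Env | A x y = true} :=
  measurable_apply x y (measurableSet_singleton true)

lemma measurable_extDeg (x : ℕ) : Measurable fun A => extDeg A x :=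
  Measurable.tsum fun y =>
    Measurable.ite (measurableSet_adj x y) measurable_const measurable_const

lemma measurable_edeg (x : ℕ) : Measurable fun A => (edeg A x : ℝ) := by
  simp_rw [edeg_eq]
  exact (measurable_extDeg x).ennreal_toReal

lemma measurable_step (x y : ℕ) : Measurable fun A => step A x y := by
  unfold step ekernel
  refine Measurable.ennreal_ofReal ?_
  split_ifs
  · exact measurable_const
  · exact Measurable.ite (measurableSet_adj x y)
      (measurable_const.div (measurable_const.mul (measurable_edeg x))) measurable_const

lemma measurable_stepPow (t x y : ℕ) : Measurable fun A => stepPow A t x y := by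
  induction t generalizing y with
  | zero => exact measurable_const
  | succ t ih => exact Measurable.tsum fun u => (ih u).mul (measurable_step u y)

lemma tsum_half_add (A : Env) (x : ℕ) :
    ∑' y, ((if y = x then (2⁻¹ : ℝ≥0∞) else 0)
      + (if A x y = true then 1 else 0) * ENNReal.ofReal (1 / (2 * (edeg A x : ℝ))))
      = 2⁻¹ + extDeg A x * ENNReal.ofReal (1 / (2 * (edeg A x : ℝ))) := by
  rw [ENNReal.tsum_add, tsum_ite_eq, ENNReal.tsum_mul_right]
  rfl

lemma extDeg_mul {x : ℕ} (h : 0 < edeg A x) :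
    extDeg A x * ENNReal.ofReal (1 / (2 * (edeg A x : ℝ))) = 2⁻¹ := by
  have hr : (0 : ℝ) < edeg A x := by exact_mod_cast h
  have htop : extDeg A x ≠ ∞ := fun h0 => by rw [edeg_eq, h0] at hr; simp at hr
  rw [edeg_eq] at hr ⊢
  rw [← ENNReal.ofReal_toReal htop, ENNReal.toReal_ofReal hr.le, ← ENNReal.ofReal_mul hr.le]
  have : (extDeg A x).toReal * (1 / (2 * (extDeg A x).toReal)) = 2⁻¹ := by field_simp
  rw [this, ENNReal.ofReal_inv_of_pos two_pos]
  simp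

lemma half_add_le (A : Env) (x : ℕ) :
    2⁻¹ + extDeg A x * ENNReal.ofReal (1 / (2 * (edeg A x : ℝ))) ≤ 1 := by
  rcases Nat.eq_zero_or_pos (edeg A x) with h | h
  · rw [h]
    simp
  · rw [extDeg_mul h, ENNReal.inv_two_add_inv_two]

lemma ofReal_half : ENNReal.ofReal (1 / 2) = 2⁻¹ := by
  rw [one_div, ENNReal.ofReal_inv_of_pos two_pos]
  simp

lemma tsum_step_le (A : Env) (x : ℕ) : ∑' y, step A x y ≤ 1 := by
  refine le_trans ?_ (half_add_le A x)
  rw [← tsum_half_add]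
  refine ENNReal.tsum_le_tsum fun y => ?_
  unfold step ekernel
  by_cases hxy : x = y
  · rw [if_pos hxy, if_pos hxy.symm, ofReal_half]
    exact le_self_add
  · rw [if_neg hxy, if_neg (Ne.symm hxy), zero_add]
    split_ifs <;> simp

lemma tsum_step (hA : Good A) (x : ℕ) : ∑' y, step A x y = 1 := by
  rw [← ENNReal.inv_two_add_inv_two]
  conv_rhs => rw [← extDeg_mul (hA x).2.2]
  rw [extDeg_mul (hA x).2.2]
  conv_rhs =>
    arg 2
    rw [← extDeg_mul (hA x).2.2]
  rw [← tsum_half_add]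
  refine tsum_congr fun y => ?_
  unfold step ekernel
  by_cases hxy : x = y
  · rw [if_pos hxy, if_pos hxy.symm, ofReal_half, ← hxy, (hA x).1]
    simp
  · rw [if_neg hxy, if_neg (Ne.symm hxy), zero_add]
    split_ifs <;> simp

lemma tsum_stepPow_le (A : Env) (t x : ℕ) : ∑' y, stepPow A t x y ≤ 1 := by
  induction t with
  | zero => simp [stepPow]
  | succ t ih =>
    simp only [stepPow]
    rw [ENNReal.tsum_comm]
    refine le_trans (ENNReal.tsum_le_tsum fun u => ?_) ih
    rw [ENNReal.tsum_mul_left]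
    exact mul_le_of_le_one_right' (tsum_step_le A u)

lemma stepPow_le_one (A : Env) (t x y : ℕ) : stepPow A t x y ≤ 1 :=
  (ENNReal.le_tsum y).trans (tsum_stepPow_le A t x)

lemma stepPow_ne_top (A : Env) (t x y : ℕ) : stepPow A t x y ≠ ∞ :=
  ne_top_of_le_ne_top ENNReal.one_ne_top (stepPow_le_one A t x y)

lemma ekernelPow_eq (A : Env) (t x y : ℕ) : ekernelPow A t x y = (stepPow A t x y).toReal := by
  induction t generalizing y with
  | zero => simp only [ekernelPow, stepPow]; split_ifs <;> simp
  | succ t ih =>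
    simp only [ekernelPow, stepPow]
    rw [ENNReal.tsum_toReal_eq
      fun u => ENNReal.mul_ne_top (stepPow_ne_top A t x u) (step_ne_top A u y)]
    refine tsum_congr fun u => ?_
    rw [ih, ENNReal.toReal_mul, step, ENNReal.toReal_ofReal (ekernel_nonneg A u y)]

lemma ofReal_ekernelPow (A : Env) (t x y : ℕ) :
    ENNReal.ofReal (ekernelPow A t x y) = stepPow A t x y := by
  rw [ekernelPow_eq, ENNReal.ofReal_toReal (stepPow_ne_top A t x y)]

lemma ekernelPow_nonneg (A : Env) (t x y : ℕ) : 0 ≤ ekernelPow A t x y := by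
  rw [ekernelPow_eq]
  exact ENNReal.toReal_nonneg

lemma ekernelPow_le_one (A : Env) (t x y : ℕ) : ekernelPow A t x y ≤ 1 := by
  rw [ekernelPow_eq]
  exact ENNReal.toReal_le_of_le_ofReal zero_le_one (by simpa using stepPow_le_one A t x y)

lemma measurable_ekernelPow (t x y : ℕ) : Measurable fun A => ekernelPow A t x y := by
  simp_rw [ekernelPow_eq]
  exact (measurable_stepPow t x y).ennreal_toReal

lemma stepPow_one (A : Env) (x y : ℕ) : stepPow A 1 x y = step A x y := by
  simp only [stepPow, ite_mul, one_mul, zero_mul]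
  exact tsum_ite_eq' x _

lemma stepPow_add (A : Env) (s t x y : ℕ) :
    stepPow A (s + t) x y = ∑' u, stepPow A s x u * stepPow A t u y := by
  induction t generalizing y with
  | zero => simp [stepPow]
  | succ t ih =>
    rw [← add_assoc]
    simp only [stepPow]
    simp_rw [ih, ← ENNReal.tsum_mul_left, ← ENNReal.tsum_mul_right]
    rw [ENNReal.tsum_comm]
    simp_rw [mul_assoc]

lemma stepPow_succ' (A : Env) (t x y : ℕ) :
    stepPow A (t + 1) x y = ∑' u, step A x u * stepPow A t u y := by
  rw [add_comm, stepPow_add]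
  simp_rw [stepPow_one]

lemma edeg_relabel (φ : ℕ ≃ ℕ) (A : Env) (x : ℕ) : edeg (relabel φ A) (φ x) = edeg A x := by
  unfold edeg relabel
  have : {y | A (φ.symm (φ x)) (φ.symm y) = true} = φ '' {y | A x y = true} := by
    ext y
    simp [Equiv.image_eq_preimage_symm]
  rw [this, Set.ncard_image_of_injective _ φ.injective]

lemma step_relabel (φ : ℕ ≃ ℕ) (A : Env) (x y : ℕ) :
    step (relabel φ A) (φ x) (φ y) = step A x y := by
  unfold step ekernel
  rw [edeg_relabel]
  simp [relabel]

lemma stepPow_relabel (φ : ℕ ≃ ℕ) (A : Env) (t x y : ℕ) :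
    stepPow (relabel φ A) t (φ x) (φ y) = stepPow A t x y := by
  induction t generalizing y with
  | zero => simp [stepPow]
  | succ t ih =>
    simp only [stepPow]
    rw [← φ.tsum_eq]
    simp_rw [ih, step_relabel]

lemma ekernelPow_relabel (φ : ℕ ≃ ℕ) (A : Env) (t x y : ℕ) :
    ekernelPow (relabel φ A) t (φ x) (φ y) = ekernelPow A t x y := by
  rw [ekernelPow_eq, ekernelPow_eq, stepPow_relabel]

lemma Good.relabel (φ : ℕ ≃ ℕ) (hA : Good A) : Good (relabel φ A) := by
  intro x
  obtain ⟨x, rfl⟩ := φ.surjective x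
  rw [edeg_relabel]
  refine ⟨by simpa [_root_.relabel] using (hA x).1, ?_, (hA x).2.2⟩
  have : {y | _root_.relabel φ A (φ x) y = true} = φ '' {y | A x y = true} := by
    ext y
    simp [Equiv.image_eq_preimage_symm, _root_.relabel]
  rw [this]
  exact (hA x).2.1.image _

lemma good_relabel_iff (φ : ℕ ≃ ℕ) (A : Env) : Good (relabel φ A) ↔ Good A := by
  refine ⟨fun h => ?_, Good.relabel φ⟩
  have := h.relabel φ.symm
  have e : relabel φ.symm (relabel φ A) = A := by
    funext x y
    simp [relabel]
  rwa [e] at this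

lemma good_iff (A : Env) :
    Good A ↔ ∀ x, A x x = false ∧ extDeg A x ≠ ∞ ∧ (0 : ℝ) < edeg A x := by
  refine forall_congr' fun x => and_congr_right fun _ => and_congr ?_ (by norm_cast)
  rw [extDeg_eq]
  simp

lemma measurableSet_good : MeasurableSet {A | Good A} := by
  simp_rw [good_iff, Set.ofPred_forall]
  refine MeasurableSet.iInter fun x => ?_
  refine MeasurableSet.inter (measurable_apply x x (measurableSet_singleton false))
    (MeasurableSet.inter ?_ ?_)
  · exact (measurable_extDeg x (measurableSet_singleton ∞)).compl
  · exact measurableSet_lt measurable_const (measurable_edeg x)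

end LazyWalk

namespace LazyWalk

variable {A : Env}

/-- The entropy of the position of the walk after `t` steps from `x`. -/
noncomputable def entropy (t : ℕ) (A : Env) (x : ℕ) : ℝ≥0∞ :=
  ∑' y, ENNReal.ofReal (Real.negMulLog (ekernelPow A t x y))

/-- The mean over one step of the entropy of the position after `t` more steps. -/
noncomputable def meanEntropy (t : ℕ) (A : Env) (x : ℕ) : ℝ≥0∞ :=
  ∑' u, step A x u * entropy t A u

lemma negMulLog_ekernelPow_nonneg (A : Env) (t x y : ℕ) :
    0 ≤ Real.negMulLog (ekernelPow A t x y) :=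
  Real.negMulLog_nonneg (ekernelPow_nonneg A t x y) (ekernelPow_le_one A t x y)

lemma tsum_mul_log_eq (A : Env) (t x : ℕ) :
    ∑' y, ekernelPow A t x y * Real.log (1 / ekernelPow A t x y) = (entropy t A x).toReal := by
  rw [entropy, ENNReal.tsum_toReal_eq fun _ => ENNReal.ofReal_ne_top]
  refine tsum_congr fun y => ?_
  rw [ENNReal.toReal_ofReal (negMulLog_ekernelPow_nonneg A t x y), one_div, Real.log_inv,
    Real.negMulLog]
  ring

lemma entropy_zero (A : Env) (x : ℕ) : entropy 0 A x = 0 := by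
  refine ENNReal.tsum_eq_zero.2 fun y => ?_
  simp only [ekernelPow]
  split_ifs <;> simp

lemma measurable_entropy (t x : ℕ) : Measurable fun A => entropy t A x :=
  Measurable.tsum fun y =>
    (Real.continuous_negMulLog.measurable.comp (measurable_ekernelPow t x y)).ennreal_ofReal

lemma measurable_meanEntropy (t x : ℕ) : Measurable fun A => meanEntropy t A x :=
  Measurable.tsum fun u => (measurable_step x u).mul (measurable_entropy t u)

lemma entropy_relabel (φ : ℕ ≃ ℕ) (t : ℕ) (A : Env) (x : ℕ) :
    entropy t (relabel φ A) (φ x) = entropy t A x := by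
  unfold entropy
  rw [← φ.tsum_eq]
  simp_rw [ekernelPow_relabel]

lemma meanEntropy_relabel (φ : ℕ ≃ ℕ) (t : ℕ) (A : Env) (x : ℕ) :
    meanEntropy t (relabel φ A) (φ x) = meanEntropy t A x := by
  unfold meanEntropy
  rw [← φ.tsum_eq]
  simp_rw [entropy_relabel, step_relabel]

lemma finite_support_step (hA : Good A) (x : ℕ) : {y | step A x y ≠ 0}.Finite := by
  refine ((hA x).2.1.insert x).subset fun y hy => ?_
  by_contra h
  simp only [Set.mem_insert_iff, Set.mem_ofPred_eq, not_or] at h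
  refine hy ?_
  simp [step, ekernel, Ne.symm h.1, h.2]

lemma finite_support_stepPow (hA : Good A) (t x : ℕ) : {y | stepPow A t x y ≠ 0}.Finite := by
  induction t with
  | zero =>
    refine (Set.finite_singleton x).subset fun y hy => ?_
    by_contra h
    exact hy (if_neg (Ne.symm h))
  | succ t ih =>
    refine (ih.biUnion fun u _ => finite_support_step hA u).subset fun y hy => ?_
    by_contra h
    simp only [Set.mem_iUnion, Set.mem_ofPred_eq, exists_prop, not_exists, not_and, not_not] at h
    refine hy (ENNReal.tsum_eq_zero.2 fun u => ?_)
    by_cases hu : stepPow A t x u = 0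
    · simp [hu]
    · simp [h u hu]

lemma stepPow_succ_ne_zero {t x u y : ℕ} (h : stepPow A t x u ≠ 0) (h' : step A u y ≠ 0) :
    stepPow A (t + 1) x y ≠ 0 := fun h0 =>
  mul_ne_zero h h' (ENNReal.tsum_eq_zero.1 h0 u)

lemma stepPow_succ'_ne_zero {t x u y : ℕ} (h : step A x u ≠ 0) (h' : stepPow A t u y ≠ 0) :
    stepPow A (t + 1) x y ≠ 0 := fun h0 => by
  rw [stepPow_succ'] at h0
  exact mul_ne_zero h h' (ENNReal.tsum_eq_zero.1 h0 u)

lemma toReal_step (A : Env) (x y : ℕ) : (step A x y).toReal = ekernel A x y :=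
  ENNReal.toReal_ofReal (ekernel_nonneg A x y)

lemma ekernelPow_succ_eq_sum {t x y : ℕ} {s : Finset ℕ} (hs : ∀ u, stepPow A t x u ≠ 0 → u ∈ s) :
    ekernelPow A (t + 1) x y = ∑ u ∈ s, ekernelPow A t x u * ekernel A u y := by
  rw [ekernelPow]
  refine tsum_eq_sum fun u hu => ?_
  rw [ekernelPow_eq, not_not.1 fun h => hu (hs u h)]
  simp

lemma ekernelPow_succ'_eq_sum {t x y : ℕ} {s : Finset ℕ} (hs : ∀ u, step A x u ≠ 0 → u ∈ s) :
    ekernelPow A (t + 1) x y = ∑ u ∈ s, ekernel A x u * ekernelPow A t u y := by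
  rw [ekernelPow_eq, stepPow_succ', ENNReal.tsum_toReal_eq fun u =>
    ENNReal.mul_ne_top (step_ne_top A x u) (stepPow_ne_top A t u y)]
  simp_rw [ENNReal.toReal_mul, toReal_step, ← ekernelPow_eq]
  refine tsum_eq_sum fun u hu => ?_
  rw [← toReal_step, not_not.1 fun h => hu (hs u h)]
  simp

lemma sum_ekernel (hA : Good A) {x : ℕ} {s : Finset ℕ} (hs : ∀ u, step A x u ≠ 0 → u ∈ s) :
    ∑ u ∈ s, ekernel A x u = 1 := by
  simp_rw [← toReal_step]
  have h : ∑' u, step A x u = ∑ u ∈ s, step A x u :=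
    tsum_eq_sum fun u hu => not_not.1 fun h => hu (hs u h)
  rw [← ENNReal.toReal_sum fun u _ => step_ne_top A x u, ← h, tsum_step hA]
  rfl

lemma entropy_eq_ofReal {t x : ℕ} {s : Finset ℕ} (hs : ∀ y, stepPow A t x y ≠ 0 → y ∈ s) :
    entropy t A x = ENNReal.ofReal (∑ y ∈ s, Real.negMulLog (ekernelPow A t x y)) := by
  rw [ENNReal.ofReal_sum_of_nonneg fun y _ => negMulLog_ekernelPow_nonneg A t x y]
  refine tsum_eq_sum fun y hy => ?_
  rw [ekernelPow_eq, not_not.1 fun h => hy (hs y h)]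
  simp

lemma meanEntropy_eq_ofReal {t x : ℕ} {s v : Finset ℕ} (hs : ∀ u, step A x u ≠ 0 → u ∈ s)
    (hv : ∀ u y, step A x u ≠ 0 → stepPow A t u y ≠ 0 → y ∈ v) :
    meanEntropy t A x = ENNReal.ofReal
      (∑ u ∈ s, ekernel A x u * ∑ y ∈ v, Real.negMulLog (ekernelPow A t u y)) := by
  rw [ENNReal.ofReal_sum_of_nonneg fun u _ => mul_nonneg (ekernel_nonneg A x u)
    (Finset.sum_nonneg fun y _ => negMulLog_ekernelPow_nonneg A t u y), meanEntropy, tsum_eq_sum]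
  · refine Finset.sum_congr rfl fun u _ => ?_
    rw [ENNReal.ofReal_mul (ekernel_nonneg A x u)]
    by_cases hu : step A x u = 0
    · rw [hu, ← step, hu, zero_mul, zero_mul]
    · rw [entropy_eq_ofReal fun y => hv u y hu]
      rfl
  · intro u hu
    rw [not_not.1 fun h => hu (hs u h), zero_mul]

lemma meanEntropy_le (hA : Good A) (t x : ℕ) : meanEntropy t A x ≤ entropy (t + 1) A x := by
  set s := (finite_support_step hA x).toFinset with hs
  set v := (finite_support_stepPow hA (t + 1) x).toFinset with hv
  have hs' : ∀ u, step A x u ≠ 0 → u ∈ s := fun u hu => by simpa [hs] using hu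
  have hv' : ∀ u, stepPow A (t + 1) x u ≠ 0 → u ∈ v := fun u hu => by simpa [hv] using hu
  rw [meanEntropy_eq_ofReal hs' fun u y hu hy => hv' y (stepPow_succ'_ne_zero hu hy),
    entropy_eq_ofReal hv']
  simp_rw [ekernelPow_succ'_eq_sum hs']
  exact ENNReal.ofReal_le_ofReal (FiniteEntropy.mean_entropy_le s v
    (fun u => ekernel_nonneg A x u) (sum_ekernel hA hs') fun u y => ekernelPow_nonneg A t u y)

lemma entropy_sub_meanEntropy_le (hA : Good A) (t x : ℕ) :
    entropy (t + 2) A x - meanEntropy (t + 1) A x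
      ≤ entropy (t + 1) A x - meanEntropy t A x := by
  set s := (finite_support_step hA x).toFinset with hs
  set v := (finite_support_stepPow hA (t + 1) x).toFinset with hv
  set w := (finite_support_stepPow hA (t + 2) x).toFinset with hw
  have hs' : ∀ u, step A x u ≠ 0 → u ∈ s := fun u hu => by simpa [hs] using hu
  have hs'' : ∀ u ∈ s, step A x u ≠ 0 := fun u hu => by simpa [hs] using hu
  have hv' : ∀ u, stepPow A (t + 1) x u ≠ 0 → u ∈ v := fun u hu => by simpa [hv] using hu
  have hv'' : ∀ u ∈ v, stepPow A (t + 1) x u ≠ 0 := fun u hu => by simpa [hv] using hu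
  have hw' : ∀ u, stepPow A (t + 2) x u ≠ 0 → u ∈ w := fun u hu => by simpa [hw] using hu
  rw [meanEntropy_eq_ofReal hs' fun u y hu hy => hv' y (stepPow_succ'_ne_zero hu hy),
    meanEntropy_eq_ofReal hs' fun u y hu hy => hw' y (stepPow_succ'_ne_zero hu hy),
    entropy_eq_ofReal hv', entropy_eq_ofReal hw']
  have hnn : ∀ (n : ℕ) (r : Finset ℕ),
      0 ≤ ∑ u ∈ s, ekernel A x u * ∑ y ∈ r, Real.negMulLog (ekernelPow A n u y) := fun n r =>
    Finset.sum_nonneg fun u _ => mul_nonneg (ekernel_nonneg A x u)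
      (Finset.sum_nonneg fun y _ => negMulLog_ekernelPow_nonneg A n u y)
  rw [← ENNReal.ofReal_sub _ (hnn _ _), ← ENNReal.ofReal_sub _ (hnn _ _)]
  refine ENNReal.ofReal_le_ofReal ?_
  have key := FiniteEntropy.entropy_sub_le s v w (fun u => ekernel_nonneg A x u)
    (fun u y => ekernelPow_nonneg A t u y) (fun u y => ekernel_nonneg A u y)
    (fun u hu => sum_ekernel hA fun y hy => hw' y (stepPow_succ_ne_zero (hv'' u hu) hy))
  have e : ∀ u ∈ s, ∀ y, ekernelPow A (t + 1) u y
      = ∑ j ∈ v, ekernelPow A t u j * ekernel A j y := fun u hu y =>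
    ekernelPow_succ_eq_sum fun j hj => hv' j (stepPow_succ'_ne_zero (hs'' u hu) hj)
  have e1 : ∑ u ∈ s, ekernel A x u * ∑ y ∈ w, Real.negMulLog (ekernelPow A (t + 1) u y)
      = ∑ u ∈ s, ekernel A x u * ∑ y ∈ w, Real.negMulLog
        (∑ j ∈ v, ekernelPow A t u j * ekernel A j y) :=
    Finset.sum_congr rfl fun u hu => by simp_rw [e u hu]
  have e2 : ∀ y, ekernelPow A (t + 2) x y
      = ∑ u ∈ s, ekernel A x u * ∑ j ∈ v, ekernelPow A t u j * ekernel A j y := fun y => by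
    rw [ekernelPow_succ'_eq_sum hs']
    exact Finset.sum_congr rfl fun u hu => by rw [e u hu]
  rw [e1]
  simp_rw [e2, ekernelPow_succ'_eq_sum (t := t) hs']
  exact key

lemma entropy_one_le (hA : Good A) (x : ℕ) :
    entropy 1 A x ≤ ENNReal.ofReal (2 * Real.log 2 + Real.log (edeg A x)) := by
  have hd : (1 : ℝ) ≤ edeg A x := by exact_mod_cast (hA x).2.2
  have hlog2 : 0 ≤ Real.log 2 := Real.log_nonneg one_le_two
  have hlog : 0 ≤ Real.log (2 * (edeg A x : ℝ)) := Real.log_nonneg (by linarith)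
  set c := ENNReal.ofReal (1 / (2 * (edeg A x : ℝ)) * Real.log (2 * (edeg A x : ℝ))) with hc
  calc entropy 1 A x
      ≤ ∑' y, ((if y = x then ENNReal.ofReal (Real.log 2) else 0)
          + (if A x y = true then 1 else 0) * c) := by
        refine ENNReal.tsum_le_tsum fun y => ?_
        have e : ekernelPow A 1 x y = ekernel A x y := by
          rw [ekernelPow_eq, stepPow_one, toReal_step]
        rw [e, ekernel]
        by_cases hxy : x = y
        · rw [if_pos hxy, if_pos hxy.symm]
          refine le_trans (ENNReal.ofReal_le_ofReal ?_) le_self_add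
          rw [Real.negMulLog, one_div, Real.log_inv]
          linarith
        · rw [if_neg hxy, if_neg (Ne.symm hxy), zero_add]
          split_ifs
          · rw [one_mul, hc, Real.negMulLog]
            refine ENNReal.ofReal_le_ofReal (le_of_eq ?_)
            conv_lhs => rw [one_div, Real.log_inv]
            rw [one_div]
            ring
          · simp
    _ = ENNReal.ofReal (Real.log 2) + extDeg A x * c := by
        rw [ENNReal.tsum_add, tsum_ite_eq, ENNReal.tsum_mul_right]
        rfl
    _ = ENNReal.ofReal (Real.log 2) + 2⁻¹ * ENNReal.ofReal (Real.log (2 * (edeg A x : ℝ))) := by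
        rw [hc, ENNReal.ofReal_mul (by positivity), ← mul_assoc, extDeg_mul (hA x).2.2]
    _ ≤ ENNReal.ofReal (Real.log 2) + ENNReal.ofReal (Real.log (2 * (edeg A x : ℝ))) := by
        gcongr
        exact mul_le_of_le_one_left' (ENNReal.inv_le_one.2 one_le_two)
    _ = ENNReal.ofReal (2 * Real.log 2 + Real.log (edeg A x)) := by
        rw [← ENNReal.ofReal_add hlog2 hlog, Real.log_mul two_ne_zero (by linarith)]
        ring_nf

end LazyWalk

namespace LazyWalk

open ProbabilityTheory

lemma measurable_uncurry {f : Env → ℕ → ℝ≥0∞} (hf : ∀ x, Measurable fun A => f A x) :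
    Measurable fun p : Env × ℕ => f p.1 p.2 :=
  measurable_from_prod_countable_left hf

/-- A rooted graph on `ℕ`. -/
structure RootedGraph where
  env : Env
  root : ℕ

/-- The σ-algebra of Borel sets invariant under rooted isomorphisms. -/
instance : MeasurableSpace RootedGraph where
  MeasurableSet' B := MeasurableSet {p : Env × ℕ | RootedGraph.mk p.1 p.2 ∈ B} ∧
    ∀ (φ : ℕ ≃ ℕ) (A : Env) (x : ℕ),
      RootedGraph.mk (relabel φ A) (φ x) ∈ B ↔ RootedGraph.mk A x ∈ B
  measurableSet_empty := ⟨MeasurableSet.empty, fun _ _ _ => Iff.rfl⟩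
  measurableSet_compl B hB := ⟨hB.1.compl, fun φ A x => not_congr (hB.2 φ A x)⟩
  measurableSet_iUnion B hB := by
    refine ⟨?_, fun φ A x => ?_⟩
    · simp_rw [Set.mem_iUnion, Set.ofPred_exists]
      exact MeasurableSet.iUnion fun i => (hB i).1
    · simp_rw [Set.mem_iUnion]
      exact exists_congr fun i => (hB i).2 φ A x

lemma measurableSet_rootedGraph_iff {B : Set RootedGraph} :
    MeasurableSet B ↔ MeasurableSet {p : Env × ℕ | RootedGraph.mk p.1 p.2 ∈ B} ∧
      ∀ (φ : ℕ ≃ ℕ) (A : Env) (x : ℕ),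
        RootedGraph.mk (relabel φ A) (φ x) ∈ B ↔ RootedGraph.mk A x ∈ B :=
  Iff.rfl

lemma measurable_of_invariant {f : Env → ℕ → ℝ≥0∞} (hf : Invariant f)
    (hm : ∀ x, Measurable fun A => f A x) :
    Measurable fun p : RootedGraph => f p.env p.root := fun B hB =>
  measurableSet_rootedGraph_iff.2 ⟨measurable_uncurry hm hB, fun φ A x => by
    simp only [Set.mem_preimage, hf φ A x]⟩

lemma measurable_mk (x : ℕ) : Measurable fun A => RootedGraph.mk A x := fun _ hB =>
  measurable_prodMk_right (measurableSet_rootedGraph_iff.1 hB).1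

lemma invariant_of_measurable {f : RootedGraph → ℝ≥0∞} (hf : Measurable f) :
    Invariant fun A x => f (RootedGraph.mk A x) := fun φ A x =>
  ((measurableSet_rootedGraph_iff.1
    (hf (measurableSet_singleton (f (RootedGraph.mk A x))))).2 φ A x).2 rfl

/-- One step of the lazy walk, as a measure on rooted graphs. -/
noncomputable def stepMeasure (p : RootedGraph) : Measure RootedGraph :=
  Measure.sum fun y => step p.env p.root y • Measure.dirac (RootedGraph.mk p.env y)

lemma lintegral_stepMeasure {f : RootedGraph → ℝ≥0∞} (hf : Measurable f) (p : RootedGraph) :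
    ∫⁻ q, f q ∂stepMeasure p = ∑' y, step p.env p.root y * f (RootedGraph.mk p.env y) := by
  rw [stepMeasure, lintegral_sum_measure]
  refine tsum_congr fun y => ?_
  rw [lintegral_smul_measure, lintegral_dirac' _ hf, smul_eq_mul]

lemma invariant_tsum_step_mul {f : Env → ℕ → ℝ≥0∞} (hf : Invariant f) :
    Invariant fun A x => ∑' y, step A x y * f A y := fun φ A x => by
  simp only
  rw [← φ.tsum_eq]
  simp_rw [step_relabel, hf φ A]

lemma measurable_stepMeasure : Measurable stepMeasure := by
  refine Measure.measurable_of_measurable_coe _ fun B hB => ?_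
  have hB' : Measurable (B.indicator (1 : RootedGraph → ℝ≥0∞)) := measurable_one.indicator hB
  have h : ∀ p : RootedGraph, stepMeasure p B
      = ∑' y, step p.env p.root y * B.indicator 1 (RootedGraph.mk p.env y) := fun p => by
    rw [← lintegral_stepMeasure hB', lintegral_indicator_one hB]
  simp_rw [h]
  exact measurable_of_invariant
    (f := fun A x => ∑' y, step A x y * B.indicator 1 (RootedGraph.mk A y))
    (invariant_tsum_step_mul (invariant_of_measurable hB'))
    fun x => Measurable.tsum fun y => (measurable_step x y).mul (hB'.comp (measurable_mk y))

lemma measurableSet_good_rootedGraph : MeasurableSet {p : RootedGraph | Good p.env} :=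
  measurableSet_rootedGraph_iff.2 ⟨measurable_fst measurableSet_good,
    fun φ A _ => good_relabel_iff φ A⟩

/-- The transition kernel of the environment seen from the lazy walk. -/
noncomputable def stepKernel : Kernel RootedGraph RootedGraph :=
  Kernel.piecewise measurableSet_good_rootedGraph ⟨stepMeasure, measurable_stepMeasure⟩ Kernel.id

lemma stepKernel_apply {p : RootedGraph} (hp : Good p.env) : stepKernel p = stepMeasure p := by
  rw [stepKernel, Kernel.piecewise_apply]
  exact if_pos hp

instance : IsMarkovKernel stepKernel := ⟨fun p => by
  by_cases hp : Good p.env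
  · rw [stepKernel_apply hp]
    refine ⟨?_⟩
    rw [← lintegral_one, lintegral_stepMeasure measurable_const]
    simpa using tsum_step hp p.root
  · have h : stepKernel p = Measure.dirac p := by
      rw [stepKernel, Kernel.piecewise_apply]
      exact (if_neg hp).trans (Kernel.id_apply p)
    rw [h]
    infer_instance⟩

lemma act_stepKernel {f : RootedGraph → ℝ≥0∞} (hf : Measurable f) {p : RootedGraph}
    (hp : Good p.env) :
    MarkovErgodic.act stepKernel f p = ∑' y, step p.env p.root y * f (RootedGraph.mk p.env y) := by
  rw [MarkovErgodic.act, stepKernel_apply hp, lintegral_stepMeasure hf]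

section Stationary

variable {Ω : Type*} [MeasurableSpace Ω] {μ : Measure Ω} {G : Ω → Env}

lemma invariant_stepKernel (hG : Measurable G) (hgood : ∀ᵐ ω ∂μ, Good (G ω))
    (hstat : ∀ h : Env → ℕ → ℝ≥0∞, Invariant h → (∀ x, Measurable fun A => h A x) →
      ∫⁻ ω, ∑' x, step (G ω) 0 x * h (G ω) x ∂μ = ∫⁻ ω, h (G ω) 0 ∂μ) :
    stepKernel.Invariant (μ.map fun ω => RootedGraph.mk (G ω) 0) := by
  have hmk : Measurable fun ω => RootedGraph.mk (G ω) 0 := (measurable_mk 0).comp hG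
  refine Measure.ext fun B hB => ?_
  have hB' : Measurable (B.indicator (1 : RootedGraph → ℝ≥0∞)) := measurable_one.indicator hB
  rw [Measure.bind_apply hB stepKernel.measurable.aemeasurable,
    lintegral_map (stepKernel.measurable_coe hB) hmk, Measure.map_apply hmk hB,
    ← lintegral_indicator_one (hmk hB)]
  refine Eq.trans ?_ (hstat (fun A x => B.indicator 1 (RootedGraph.mk A x))
    (invariant_of_measurable hB') fun x => hB'.comp (measurable_mk x))
  refine lintegral_congr_ae ?_
  filter_upwards [hgood] with ω hω
  rw [stepKernel_apply hω, ← lintegral_indicator_one hB, lintegral_stepMeasure hB']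

/-- Existence of the asymptotic entropy of a stationary random rooted graph, almost surely and in
mean. -/
theorem exists_tendsto_entropy [IsProbabilityMeasure μ] (hG : Measurable G)
    (hgood : ∀ᵐ ω ∂μ, Good (G ω))
    (hstat : ∀ h : Env → ℕ → ℝ≥0∞, Invariant h → (∀ x, Measurable fun A => h A x) →
      ∫⁻ ω, ∑' x, step (G ω) 0 x * h (G ω) x ∂μ = ∫⁻ ω, h (G ω) 0 ∂μ)
    (hint : Integrable (fun ω => Real.log (edeg (G ω) 0)) μ) :
    ∃ h : Env → ℝ≥0∞, Measurable h ∧ ∫⁻ ω, h (G ω) ∂μ ≠ ∞ ∧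
      (∀ t, ∫⁻ ω, entropy t (G ω) 0 ∂μ ≠ ∞) ∧
      (∀ᵐ ω ∂μ, Tendsto (fun t : ℕ => entropy t (G ω) 0 / t) atTop (nhds (h (G ω)))) ∧
      Tendsto (fun t : ℕ => (∫⁻ ω, entropy t (G ω) 0 ∂μ) / t) atTop
        (nhds (∫⁻ ω, h (G ω) ∂μ)) := by
  have hmk : Measurable fun ω => RootedGraph.mk (G ω) 0 := (measurable_mk 0).comp hG
  set ν := μ.map fun ω => RootedGraph.mk (G ω) 0 with hν
  have : IsProbabilityMeasure ν := Measure.isProbabilityMeasure_map hmk.aemeasurable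
  have hgood' : ∀ᵐ p ∂ν, Good p.env :=
    (ae_map_iff hmk.aemeasurable measurableSet_good_rootedGraph).2 hgood
  have hHm : ∀ t, Measurable fun p : RootedGraph => entropy t p.env p.root := fun t =>
    measurable_of_invariant (fun φ A x => entropy_relabel φ t A x) fun x => measurable_entropy t x
  have hMm : ∀ t, Measurable fun p : RootedGraph => meanEntropy t p.env p.root := fun t =>
    measurable_of_invariant (fun φ A x => meanEntropy_relabel φ t A x)
      fun x => measurable_meanEntropy t x
  obtain ⟨h, hm, hfin, hHfin, hae, hlim⟩ := MarkovErgodic.exists_tendsto_of_antitone_increments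
    (invariant_stepKernel hG hgood hstat) (H := fun t p => entropy t p.env p.root)
    (D := fun t p => entropy (t + 1) p.env p.root - meanEntropy t p.env p.root) hHm
    (fun t => (hHm (t + 1)).sub (hMm t))
    (ae_of_all _ fun p => entropy_zero p.env p.root)
    (fun t => by
      filter_upwards [hgood'] with p hp
      rw [act_stepKernel (hHm t) hp]
      exact (tsub_add_cancel_of_le (meanEntropy_le hp t p.root)).symm)
    (fun t => by
      filter_upwards [hgood'] with p hp
      exact entropy_sub_meanEntropy_le hp t p.root)
    (by
      have hm : Measurable fun p : RootedGraph =>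
          entropy (0 + 1) p.env p.root - meanEntropy 0 p.env p.root := (hHm 1).sub (hMm 0)
      rw [lintegral_map hm hmk]
      have hi : Integrable (fun ω => 2 * Real.log 2 + Real.log (edeg (G ω) 0)) μ :=
        (integrable_const _).add hint
      refine ne_top_of_le_ne_top hi.lintegral_lt_top.ne (lintegral_mono_ae ?_)
      filter_upwards [hgood] with ω hω
      exact tsub_le_self.trans (entropy_one_le hω 0))
  rw [lintegral_map hm hmk] at hfin hlim
  simp_rw [lintegral_map (hHm _) hmk] at hHfin hlim
  exact ⟨fun A => h (RootedGraph.mk A 0), hm.comp (measurable_mk 0), hfin, hHfin,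
    ae_of_ae_map hmk.aemeasurable hae, hlim⟩

end Stationary

end LazyWalk

/-- Scheffé's lemma for extended nonnegative functions. -/
lemma tendsto_integral_abs_toReal_sub {Ω : Type*} [MeasurableSpace Ω] {μ : Measure Ω}
    {f : ℕ → Ω → ℝ≥0∞} {g : Ω → ℝ≥0∞} (hf : ∀ n, Measurable (f n)) (hg : Measurable g)
    (hfi : ∀ n, ∫⁻ ω, f n ω ∂μ ≠ ∞) (hgi : ∫⁻ ω, g ω ∂μ ≠ ∞)
    (hae : ∀ᵐ ω ∂μ, Tendsto (fun n => (f n ω).toReal) atTop (nhds (g ω).toReal))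
    (hlim : Tendsto (fun n => ∫⁻ ω, f n ω ∂μ) atTop (nhds (∫⁻ ω, g ω ∂μ))) :
    Tendsto (fun n => ∫ ω, |(f n ω).toReal - (g ω).toReal| ∂μ) atTop (nhds 0) := by
  have hfI : ∀ n, Integrable (fun ω => (f n ω).toReal) μ := fun n =>
    integrable_toReal_of_lintegral_ne_top (hf n).aemeasurable (hfi n)
  have hgI : Integrable (fun ω => (g ω).toReal) μ :=
    integrable_toReal_of_lintegral_ne_top hg.aemeasurable hgi
  have hpI : ∀ n, Integrable (fun ω => max ((g ω).toReal - (f n ω).toReal) 0) μ := fun n =>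
    (hgI.sub (hfI n)).pos_part
  have hsI : ∀ n, Integrable (fun ω => (f n ω).toReal - (g ω).toReal) μ := fun n =>
    (hfI n).sub hgI
  have hsplit : ∀ n, ∫ ω, |(f n ω).toReal - (g ω).toReal| ∂μ
      = (∫⁻ ω, f n ω ∂μ).toReal - (∫⁻ ω, g ω ∂μ).toReal
        + 2 * ∫ ω, max ((g ω).toReal - (f n ω).toReal) 0 ∂μ := fun n => by
    rw [← integral_toReal (hf n).aemeasurable (ae_lt_top (hf n) (hfi n)),
      ← integral_toReal hg.aemeasurable (ae_lt_top hg hgi), ← integral_sub (hfI n) hgI,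
      ← integral_const_mul, ← integral_add (hsI n) ((hpI n).const_mul 2)]
    refine integral_congr_ae (ae_of_all _ fun ω => ?_)
    simp only
    rcases le_total (f n ω).toReal (g ω).toReal with h | h
    · rw [abs_of_nonpos (by linarith), max_eq_left (by linarith)]
      ring
    · rw [abs_of_nonneg (by linarith), max_eq_right (by linarith)]
      ring
  have h1 : Tendsto (fun n => (∫⁻ ω, f n ω ∂μ).toReal - (∫⁻ ω, g ω ∂μ).toReal) atTop (nhds 0) := by
    have := ((ENNReal.tendsto_toReal hgi).comp hlim).sub_const (∫⁻ ω, g ω ∂μ).toReal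
    rwa [sub_self] at this
  have h2 : Tendsto (fun n => ∫ ω, max ((g ω).toReal - (f n ω).toReal) 0 ∂μ) atTop
      (nhds (∫ _, (0 : ℝ) ∂μ)) := by
    refine tendsto_integral_of_dominated_convergence (fun ω => (g ω).toReal)
      (fun n => (hpI n).aestronglyMeasurable) hgI (fun n => ae_of_all _ fun ω => ?_) ?_
    · rw [Real.norm_of_nonneg (le_max_right _ _)]
      exact max_le (sub_le_self _ ENNReal.toReal_nonneg) ENNReal.toReal_nonneg
    · filter_upwards [hae] with ω hω
      have := (hω.const_sub (g ω).toReal).max (tendsto_const_nhds (x := (0 : ℝ)))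
      simpa using this
  simp_rw [hsplit]
  simpa using h1.add (h2.const_mul 2)

namespace LazyWalk

theorem exists_tendsto_entropy_toReal {Ω : Type*} [MeasurableSpace Ω] {μ : Measure Ω} {G : Ω → Env}
    [IsProbabilityMeasure μ] (hG : Measurable G) (hgood : ∀ᵐ ω ∂μ, Good (G ω))
    (hstat : ∀ h : Env → ℕ → ℝ≥0∞, Invariant h → (∀ x, Measurable fun A => h A x) →
      ∫⁻ ω, ∑' x, step (G ω) 0 x * h (G ω) x ∂μ = ∫⁻ ω, h (G ω) 0 ∂μ)
    (hint : Integrable (fun ω => Real.log (edeg (G ω) 0)) μ) :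
    ∃ H : Env → ℝ,
      (∀ᵐ ω ∂μ, Tendsto (fun t : ℕ => (entropy t (G ω) 0).toReal / t) atTop (nhds (H (G ω)))) ∧
      Tendsto (fun t : ℕ => ∫ ω, |(entropy t (G ω) 0).toReal / t - H (G ω)| ∂μ) atTop
        (nhds 0) := by
  obtain ⟨h, hm, hfin, hHfin, hae, hlim⟩ := exists_tendsto_entropy hG hgood hstat hint
  have hdiv : ∀ (t : ℕ) (A : Env),
      (entropy t A 0).toReal / t = (entropy t A 0 / (t : ℝ≥0∞)).toReal := fun t A => by
    rw [ENNReal.toReal_div, ENNReal.toReal_natCast]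
  have hae' : ∀ᵐ ω ∂μ, Tendsto (fun t : ℕ => (entropy t (G ω) 0 / (t : ℝ≥0∞)).toReal) atTop
      (nhds (h (G ω)).toReal) := by
    filter_upwards [hae, ae_lt_top (hm.comp hG) hfin] with ω hω hω'
    exact (ENNReal.tendsto_toReal hω'.ne).comp hω
  have hem : ∀ t, Measurable fun ω => entropy t (G ω) 0 := fun t => (measurable_entropy t 0).comp hG
  have hint_div : ∀ t : ℕ, ∫⁻ ω, entropy t (G ω) 0 / (t : ℝ≥0∞) ∂μ
      = (∫⁻ ω, entropy t (G ω) 0 ∂μ) / t := fun t => by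
    simp_rw [div_eq_mul_inv]
    exact lintegral_mul_const _ (hem t)
  refine ⟨fun A => (h A).toReal, ?_, ?_⟩
  · simp_rw [hdiv]
    exact hae'
  · simp_rw [hdiv]
    refine tendsto_integral_abs_toReal_sub (fun t => (hem t).div_const _) (hm.comp hG)
      (fun t => ?_) hfin hae' ?_
    · rcases Nat.eq_zero_or_pos t with rfl | ht
      · simp [entropy_zero]
      · rw [hint_div]
        exact ENNReal.div_ne_top (hHfin t) (by exact_mod_cast ht.ne')
    · simp_rw [hint_div]
      exact hlim

end LazyWalk

namespace LazyWalk

section Walk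

variable {μ : Measure (Env × (ℕ → ℕ))}

/-- The quenched probability that the walk started at `0` follows `path` up to time `s`. -/
noncomputable def pathWeight (s : ℕ) (path : ℕ → ℕ) (A : Env) : ℝ≥0∞ :=
  (if path 0 = 0 then 1 else 0) * ∏ i ∈ Finset.range s, step A (path i) (path (i + 1))

lemma measurable_pathWeight (s : ℕ) (path : ℕ → ℕ) : Measurable (pathWeight s path) :=
  measurable_const.mul (Finset.measurable_fun_prod _ fun _ _ => measurable_step _ _)

lemma pathWeight_update (s : ℕ) (path : ℕ → ℕ) (u : ℕ) (A : Env) :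
    pathWeight (s + 1) (Function.update path (s + 1) u) A
      = pathWeight s path A * step A (path s) u := by
  unfold pathWeight
  rw [Finset.prod_range_succ, ← mul_assoc, Function.update_self,
    Function.update_of_ne (by omega : s ≠ s + 1), Function.update_of_ne (by omega : 0 ≠ s + 1)]
  congr 2
  refine Finset.prod_congr rfl fun i hi => ?_
  have := Finset.mem_range.1 hi
  rw [Function.update_of_ne (by omega : i ≠ s + 1),
    Function.update_of_ne (by omega : i + 1 ≠ s + 1)]

/-- The law of the walk is the annealed law of the lazy random walk from `0`. -/
def IsLazyWalk (μ : Measure (Env × (ℕ → ℕ))) : Prop :=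
  ∀ (s : ℕ) (path : ℕ → ℕ) (B : Set Env), MeasurableSet B →
    μ {ω | ω.1 ∈ B ∧ ∀ i ≤ s, ω.2 i = path i}
      = ∫⁻ A in B, pathWeight s path A ∂(μ.map Prod.fst)

lemma measurable_walk (s : ℕ) : Measurable fun ω : Env × (ℕ → ℕ) => ω.2 s :=
  (measurable_pi_apply s).comp measurable_snd

lemma measurableSet_walk_eq (s x : ℕ) : MeasurableSet {ω : Env × (ℕ → ℕ) | ω.2 s = x} :=
  measurable_walk s (measurableSet_singleton x)

lemma measurableSet_cylinder {B : Set Env} (hB : MeasurableSet B) (s : ℕ) (path : ℕ → ℕ) :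
    MeasurableSet {ω : Env × (ℕ → ℕ) | ω.1 ∈ B ∧ ∀ i ≤ s, ω.2 i = path i} := by
  have h : {ω : Env × (ℕ → ℕ) | ω.1 ∈ B ∧ ∀ i ≤ s, ω.2 i = path i}
      = Prod.fst ⁻¹' B ∩ ⋂ i, ⋂ _ : i ≤ s, {ω : Env × (ℕ → ℕ) | ω.2 i = path i} := by
    ext ω
    simp
  rw [h]
  exact (measurable_fst hB).inter
    (MeasurableSet.iInter fun i => MeasurableSet.iInter fun _ => measurableSet_walk_eq i _)

/-- A measure is the sum of the measures of the level sets of a discrete random variable. -/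
lemma measure_eq_tsum_inter (s : ℕ) {E : Set (Env × (ℕ → ℕ))} (hE : MeasurableSet E) :
    μ E = ∑' u, μ (E ∩ {ω | ω.2 s = u}) := by
  rw [← measure_iUnion]
  · congr 1
    ext ω
    simp
  · intro u v huv
    refine Set.disjoint_left.2 fun ω h h' => huv ?_
    exact h.2.symm.trans h'.2
  · exact fun u => hE.inter (measurableSet_walk_eq s u)

lemma measure_cylinder_inter_shift {B : Set Env} {E : ℕ → Set (Env × (ℕ → ℕ))}
    (hB : MeasurableSet B) (hE : ∀ s, MeasurableSet (E s)) {g : Env → ℕ → ℝ≥0∞}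
    (hg : ∀ u, Measurable fun A => g A u)
    (h : ∀ s path, μ ({ω | ω.1 ∈ B ∧ ∀ i ≤ s, ω.2 i = path i} ∩ E s)
      = ∫⁻ A in B, pathWeight s path A * g A (path s) ∂(μ.map Prod.fst)) (j s : ℕ)
    (path : ℕ → ℕ) :
    μ ({ω | ω.1 ∈ B ∧ ∀ i ≤ s, ω.2 i = path i} ∩ E (s + j))
      = ∫⁻ A in B, pathWeight s path A * ∑' u, stepPow A j (path s) u * g A u
        ∂(μ.map Prod.fst) := by
  induction j generalizing s path with
  | zero =>
    rw [add_zero, h]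
    refine lintegral_congr fun A => ?_
    simp only [stepPow, ite_mul, one_mul, zero_mul]
    rw [tsum_ite_eq']
  | succ j ih =>
    rw [measure_eq_tsum_inter (s + 1) ((measurableSet_cylinder hB s path).inter (hE _))]
    have hset : ∀ u, ({ω : Env × (ℕ → ℕ) | ω.1 ∈ B ∧ ∀ i ≤ s, ω.2 i = path i}
        ∩ E (s + (j + 1))) ∩ {ω | ω.2 (s + 1) = u}
        = {ω | ω.1 ∈ B ∧ ∀ i ≤ s + 1, ω.2 i = Function.update path (s + 1) u i}
          ∩ E (s + 1 + j) := fun u => by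
      rw [show s + (j + 1) = s + 1 + j by ring, Set.inter_right_comm]
      congr 1
      ext ω
      constructor
      · rintro ⟨⟨h1, h2⟩, h3⟩
        refine ⟨h1, fun i hi => ?_⟩
        rcases Nat.le_succ_iff.1 hi with hi | rfl
        · rw [Function.update_of_ne (by omega), h2 i hi]
        · rw [Nat.succ_eq_add_one, Function.update_self]
          exact h3
      · rintro ⟨h1, h2⟩
        refine ⟨⟨h1, fun i hi => ?_⟩, ?_⟩
        · rw [h2 i (by omega), Function.update_of_ne (by omega)]
        · exact (h2 (s + 1) le_rfl).trans (Function.update_self _ _ _)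
    simp_rw [hset, ih, Function.update_self, pathWeight_update]
    have hterm : ∀ u, Measurable fun A =>
        pathWeight s path A * step A (path s) u * ∑' v, stepPow A j u v * g A v := fun u =>
      ((measurable_pathWeight s path).mul (measurable_step _ _)).mul
        (Measurable.tsum fun v => (measurable_stepPow j u v).mul (hg v))
    rw [← lintegral_tsum fun u => (hterm u).aemeasurable]
    refine lintegral_congr fun A => ?_
    simp_rw [mul_assoc]
    rw [ENNReal.tsum_mul_left]
    congr 1
    simp_rw [stepPow_succ', ← ENNReal.tsum_mul_left, ← ENNReal.tsum_mul_right]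
    rw [ENNReal.tsum_comm]
    simp_rw [mul_assoc]

lemma IsLazyWalk.measure_cylinder_inter (hμ : IsLazyWalk μ) {B : Set Env} (hB : MeasurableSet B)
    (s k : ℕ) (path : ℕ → ℕ) (y : ℕ) :
    μ ({ω | ω.1 ∈ B ∧ ∀ i ≤ s, ω.2 i = path i} ∩ {ω | ω.2 (s + k) = y})
      = ∫⁻ A in B, pathWeight s path A * stepPow A k (path s) y ∂(μ.map Prod.fst) := by
  rw [measure_cylinder_inter_shift (E := fun s => {ω | ω.2 s = y})
    (g := fun _ u => if u = y then 1 else 0) hB (fun s => measurableSet_walk_eq s y)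
    (fun _ => measurable_const)]
  · simp
  · intro s path
    by_cases hy : path s = y
    · simp only [if_pos hy, mul_one, ← hμ s path B hB]
      congr 1
      ext ω
      simp only [Set.mem_inter_iff, Set.mem_ofPred_eq, and_iff_left_iff_imp]
      exact fun h => (h.2 s le_rfl).trans hy
    · simp only [if_neg hy, mul_zero, lintegral_zero]
      convert measure_empty (μ := μ)
      ext ω
      simp only [Set.mem_inter_iff, Set.mem_ofPred_eq, Set.mem_empty_iff_false, iff_false, not_and]
      exact fun h h' => hy ((h.2 s le_rfl).symm.trans h')

lemma IsLazyWalk.ae_zero [IsProbabilityMeasure μ] (hμ : IsLazyWalk μ) :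
    ∀ᵐ ω ∂μ, ω.2 0 = 0 := by
  have h := hμ 0 (fun _ => 0) Set.univ MeasurableSet.univ
  have hp : IsProbabilityMeasure (μ.map Prod.fst) :=
    Measure.isProbabilityMeasure_map measurable_fst.aemeasurable
  simp only [pathWeight, Set.mem_univ, true_and, nonpos_iff_eq_zero, forall_eq, if_true,
    Finset.range_zero, Finset.prod_empty, mul_one, lintegral_const, Measure.restrict_univ,
    measure_univ] at h
  exact (mem_ae_iff_prob_eq_one (measurableSet_walk_eq 0 0)).2 h

/-- The joint law of the graph and of two positions of the walk. -/
lemma IsLazyWalk.measure_pair [IsProbabilityMeasure μ] (hμ : IsLazyWalk μ) {B : Set Env}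
    (hB : MeasurableSet B) (s k x y : ℕ) :
    μ {ω | ω.1 ∈ B ∧ ω.2 s = x ∧ ω.2 (s + k) = y}
      = ∫⁻ A in B, stepPow A s 0 x * stepPow A k x y ∂(μ.map Prod.fst) := by
  have h := measure_cylinder_inter_shift (μ := μ)
    (E := fun s => {ω | ω.2 s = x} ∩ {ω | ω.2 (s + k) = y})
    (g := fun A u => if u = x then stepPow A k x y else 0) hB
    (fun s => (measurableSet_walk_eq s x).inter (measurableSet_walk_eq _ y))
    (fun u => by split_ifs; exacts [measurable_stepPow k x y, measurable_const]) ?_ s 0 fun _ => 0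
  · have e : μ {ω | ω.1 ∈ B ∧ ω.2 s = x ∧ ω.2 (s + k) = y}
        = μ ({ω | ω.1 ∈ B ∧ ∀ i ≤ 0, ω.2 i = 0} ∩
          ({ω | ω.2 (0 + s) = x} ∩ {ω | ω.2 (0 + s + k) = y})) := by
      refine measure_congr (Filter.eventuallyEq_set.2 ?_)
      filter_upwards [hμ.ae_zero] with ω hω
      simp [hω]
    rw [e, h]
    refine lintegral_congr fun A => ?_
    simp [pathWeight]
  · intro s path
    by_cases hx : path s = x
    · simp only [if_pos hx]
      have := hμ.measure_cylinder_inter hB s k path y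
      rw [hx] at this
      rw [← this]
      congr 1
      ext ω
      simp only [Set.mem_inter_iff, Set.mem_ofPred_eq, and_congr_right_iff, and_iff_right_iff_imp]
      exact fun h _ => (h.2 s le_rfl).trans hx
    · simp only [if_neg hx, mul_zero, lintegral_zero]
      convert measure_empty (μ := μ)
      ext ω
      simp only [Set.mem_inter_iff, Set.mem_ofPred_eq, Set.mem_empty_iff_false, iff_false, not_and]
      exact fun h h' => absurd ((h.2 s le_rfl).symm.trans h') hx

lemma IsLazyWalk.ae_stepPow_ne_zero [IsProbabilityMeasure μ] (hμ : IsLazyWalk μ) (s k : ℕ) :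
    ∀ᵐ ω ∂μ, stepPow ω.1 s 0 (ω.2 s) ≠ 0 ∧ stepPow ω.1 k (ω.2 s) (ω.2 (s + k)) ≠ 0 := by
  have h : ∀ x y : ℕ, ∀ᵐ ω ∂μ, ¬ (ω.1 ∈ {A | stepPow A s 0 x * stepPow A k x y = 0} ∧
      ω.2 s = x ∧ ω.2 (s + k) = y) := fun x y => by
    have hB : MeasurableSet {A | stepPow A s 0 x * stepPow A k x y = 0} :=
      ((measurable_stepPow s 0 x).mul (measurable_stepPow k x y)) (measurableSet_singleton 0)
    rw [ae_iff]
    simp only [not_not]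
    rw [hμ.measure_pair hB, setLIntegral_congr_fun hB fun A hA => hA, lintegral_zero]
  filter_upwards [ae_all_iff.2 fun x => ae_all_iff.2 (h x)] with ω hω
  have := hω (ω.2 s) (ω.2 (s + k))
  simpa [not_or] using this

lemma neg_log_ekernelPow_add_le {A : Env} {s k x y z : ℕ} (h : stepPow A s x y ≠ 0)
    (h' : stepPow A k y z ≠ 0) :
    -Real.log (ekernelPow A (s + k) x z)
      ≤ -Real.log (ekernelPow A s x y) + -Real.log (ekernelPow A k y z) := by
  have hle : stepPow A s x y * stepPow A k y z ≤ stepPow A (s + k) x z := by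
    rw [stepPow_add]
    exact ENNReal.le_tsum (f := fun u => stepPow A s x u * stepPow A k u z) y
  have h1 := ENNReal.toReal_pos h (stepPow_ne_top A s x y)
  have h2 := ENNReal.toReal_pos h' (stepPow_ne_top A k y z)
  have h3 := ENNReal.toReal_mono (stepPow_ne_top A (s + k) x z) hle
  rw [ENNReal.toReal_mul] at h3
  simp_rw [ekernelPow_eq]
  rw [← neg_add, neg_le_neg_iff, ← Real.log_mul h1.ne' h2.ne']
  exact Real.log_le_log (mul_pos h1 h2) h3

lemma measurable_neg_log_ekernelPow (s k : ℕ) : Measurable fun ω : Env × (ℕ → ℕ) =>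
    -Real.log (ekernelPow ω.1 k (ω.2 s) (ω.2 (s + k))) := by
  have h : Measurable fun p : Env × (ℕ × ℕ) => -Real.log (ekernelPow p.1 k p.2.1 p.2.2) :=
    measurable_from_prod_countable_left fun q =>
      (Real.measurable_log.comp (measurable_ekernelPow k q.1 q.2)).neg
  exact h.comp (measurable_fst.prodMk ((measurable_walk s).prodMk (measurable_walk (s + k))))

/-- The quenched probability that `-log P^k(x, X_k)` lies in `C` for the walk from `x`. -/
noncomputable def logProb (k : ℕ) (C : Set ℝ) (A : Env) (x : ℕ) : ℝ≥0∞ :=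
  ∑' y, stepPow A k x y * C.indicator 1 (-Real.log (ekernelPow A k x y))

lemma invariant_logProb (k : ℕ) (C : Set ℝ) : Invariant (logProb k C) := fun φ A x => by
  unfold logProb
  rw [← φ.tsum_eq]
  simp_rw [stepPow_relabel, ekernelPow_relabel]

lemma measurable_indicator_log {C : Set ℝ} (hC : MeasurableSet C) (k x y : ℕ) :
    Measurable fun A => C.indicator (1 : ℝ → ℝ≥0∞) (-Real.log (ekernelPow A k x y)) :=
  (measurable_one.indicator hC).comp (Real.measurable_log.comp (measurable_ekernelPow k x y)).neg

lemma measurable_logProb {C : Set ℝ} (hC : MeasurableSet C) (k x : ℕ) :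
    Measurable fun A => logProb k C A x :=
  Measurable.tsum fun y => (measurable_stepPow k x y).mul (measurable_indicator_log hC k x y)

lemma IsLazyWalk.map_log_apply [IsProbabilityMeasure μ] (hμ : IsLazyWalk μ) (s k : ℕ) {C : Set ℝ}
    (hC : MeasurableSet C) :
    μ.map (fun ω => -Real.log (ekernelPow ω.1 k (ω.2 s) (ω.2 (s + k)))) C
      = ∫⁻ ω, ∑' x, stepPow ω.1 s 0 x * logProb k C ω.1 x ∂μ := by
  have hm := measurable_neg_log_ekernelPow s k
  rw [Measure.map_apply hm hC, measure_eq_tsum_inter s (hm hC)]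
  have hB : ∀ x y, MeasurableSet {A | -Real.log (ekernelPow A k x y) ∈ C} := fun x y =>
    (Real.measurable_log.comp (measurable_ekernelPow k x y)).neg hC
  have hx : ∀ x, μ ((fun ω : Env × (ℕ → ℕ) =>
      -Real.log (ekernelPow ω.1 k (ω.2 s) (ω.2 (s + k)))) ⁻¹' C ∩ {ω | ω.2 s = x})
      = ∫⁻ A, stepPow A s 0 x * logProb k C A x ∂(μ.map Prod.fst) := fun x => by
    rw [measure_eq_tsum_inter (s + k) ((hm hC).inter (measurableSet_walk_eq s x))]
    have hy : ∀ y, μ ((fun ω : Env × (ℕ → ℕ) =>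
        -Real.log (ekernelPow ω.1 k (ω.2 s) (ω.2 (s + k)))) ⁻¹' C ∩ {ω | ω.2 s = x}
          ∩ {ω | ω.2 (s + k) = y})
        = ∫⁻ A, stepPow A s 0 x * (stepPow A k x y *
          C.indicator 1 (-Real.log (ekernelPow A k x y))) ∂(μ.map Prod.fst) := fun y => by
      have hset : (fun ω : Env × (ℕ → ℕ) =>
          -Real.log (ekernelPow ω.1 k (ω.2 s) (ω.2 (s + k)))) ⁻¹' C ∩ {ω | ω.2 s = x}
            ∩ {ω | ω.2 (s + k) = y}
          = {ω | ω.1 ∈ {A | -Real.log (ekernelPow A k x y) ∈ C} ∧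
            ω.2 s = x ∧ ω.2 (s + k) = y} := by
        ext ω
        simp only [Set.mem_inter_iff, Set.mem_preimage, Set.mem_ofPred_eq, and_assoc]
        constructor
        · rintro ⟨h1, h2, h3⟩
          rw [h2, h3] at h1
          exact ⟨h1, h2, h3⟩
        · rintro ⟨h1, h2, h3⟩
          rw [h2, h3]
          exact ⟨h1, rfl, rfl⟩
      rw [hset, hμ.measure_pair (hB x y), ← lintegral_indicator (hB x y)]
      refine lintegral_congr fun A => ?_
      by_cases hA : -Real.log (ekernelPow A k x y) ∈ C
      · rw [Set.indicator_of_mem (by exact hA), Set.indicator_of_mem hA, Pi.one_apply, mul_one]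
      · rw [Set.indicator_of_notMem (by exact hA), Set.indicator_of_notMem hA, mul_zero, mul_zero]
    simp_rw [hy]
    have hterm : ∀ y, Measurable fun A => stepPow A s 0 x *
        (stepPow A k x y * C.indicator 1 (-Real.log (ekernelPow A k x y))) := fun y =>
      (measurable_stepPow s 0 x).mul
        ((measurable_stepPow k x y).mul (measurable_indicator_log hC k x y))
    rw [← lintegral_tsum fun y => (hterm y).aemeasurable]
    simp_rw [ENNReal.tsum_mul_left]
    rfl
  have hterm : ∀ x, Measurable fun A => stepPow A s 0 x * logProb k C A x := fun x =>
    (measurable_stepPow s 0 x).mul (measurable_logProb hC k x)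
  simp_rw [hx]
  rw [← lintegral_tsum fun x => (hterm x).aemeasurable,
    lintegral_map (Measurable.tsum hterm) measurable_fst]

end Walk

end LazyWalk

/-- **Asymptotic entropy of stationary random graphs (Kingman).** Let `(G,o)` be a random
rooted graph with stationary law `L` satisfying `E[log deg o] < ∞`, and let `X` be the lazy
simple random walk started at the root, with `Z_{s,t} = -log P^{t-s}(X_s, X_t)`.  Then
`Z_{s,t}` has the same distribution as `Z_{0,t-s}`; `Z_{0,t} ≤ Z_{0,s} + Z_{s,t}` (a.s.) for
`0 ≤ s ≤ t`; consequently the asymptotic entropy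
`H(G,o) = lim_t (1/t) ∑_x P^t(o,x) log(1/P^t(o,x))` exists almost surely and in `L¹`.
Here the underlying probability space is `Ω = Env × (ℕ → ℕ)`, with the environment as first
coordinate, the walk as second coordinate (its annealed law specified through cylinder
events), and stationarity is expressed by the re-rooting identity for invariant Borel
functions. -/
theorem asymptotic_entropy_exists (μ : Measure (Env × (ℕ → ℕ))) [IsProbabilityMeasure μ]
    (hgraph : ∀ᵐ ω ∂μ, (∀ x y : ℕ, ω.1 x y = ω.1 y x) ∧ (∀ x : ℕ, ω.1 x x = false) ∧
      (∀ x : ℕ, {y | ω.1 x y = true}.Finite) ∧ (∀ x : ℕ, 0 < edeg ω.1 x))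
    (hwalk : ∀ (t : ℕ) (path : ℕ → ℕ) (B : Set Env), MeasurableSet B →
      μ {ω | ω.1 ∈ B ∧ ∀ s ≤ t, ω.2 s = path s}
        = ∫⁻ A in B, ENNReal.ofReal ((if path 0 = 0 then 1 else 0) *
            ∏ s ∈ Finset.range t, ekernel A (path s) (path (s + 1))) ∂(μ.map Prod.fst))
    (hstat : ∀ (t : ℕ) (h : Env → ℕ → ℝ≥0∞), Invariant h →
      Measurable (fun p : Env × ℕ => h p.1 p.2) →
      ∫⁻ ω, ∑' x, ENNReal.ofReal (ekernelPow ω.1 t 0 x) * h ω.1 x ∂μ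
        = ∫⁻ ω, h ω.1 0 ∂μ)
    (hint : Integrable (fun ω : Env × (ℕ → ℕ) => Real.log (edeg ω.1 0)) μ) :
    -- (a) equidistribution: `Z_{s,t} ~ Z_{0,t-s}`
    (∀ s t : ℕ, s ≤ t →
      μ.map (fun ω => -Real.log (ekernelPow ω.1 (t - s) (ω.2 s) (ω.2 t)))
        = μ.map (fun ω => -Real.log (ekernelPow ω.1 (t - s) (ω.2 0) (ω.2 (t - s))))) ∧
    -- (b) subadditivity: `Z_{0,t} ≤ Z_{0,s} + Z_{s,t}`
    (∀ s t : ℕ, s ≤ t → ∀ᵐ ω ∂μ,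
      -Real.log (ekernelPow ω.1 t (ω.2 0) (ω.2 t))
        ≤ -Real.log (ekernelPow ω.1 s (ω.2 0) (ω.2 s))
          + -Real.log (ekernelPow ω.1 (t - s) (ω.2 s) (ω.2 t))) ∧
    -- (c) the asymptotic entropy exists, a.s. and in `L¹`
    (∃ H : Env → ℝ,
      (∀ᵐ ω ∂μ, Tendsto
        (fun t : ℕ =>
          (∑' x, ekernelPow ω.1 t 0 x * Real.log (1 / ekernelPow ω.1 t 0 x)) / t)
        atTop (nhds (H ω.1))) ∧
      Tendsto (fun t : ℕ =>
        ∫ ω, |(∑' x, ekernelPow ω.1 t 0 x * Real.log (1 / ekernelPow ω.1 t 0 x)) / t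
            - H ω.1| ∂μ)
        atTop (nhds 0)) := by
  have hwalk' : LazyWalk.IsLazyWalk μ := fun s path B hB => by
    rw [hwalk s path B hB]
    refine lintegral_congr fun A => ?_
    rw [ENNReal.ofReal_mul (by split_ifs <;> simp),
      ENNReal.ofReal_prod_of_nonneg fun i _ => LazyWalk.ekernel_nonneg A _ _]
    unfold LazyWalk.pathWeight LazyWalk.step
    split_ifs <;> simp
  have hstat' : ∀ (t : ℕ) (h : Env → ℕ → ℝ≥0∞), Invariant h →
      (∀ x, Measurable fun A => h A x) →
      ∫⁻ ω, ∑' x, LazyWalk.stepPow ω.1 t 0 x * h ω.1 x ∂μ = ∫⁻ ω, h ω.1 0 ∂μ :=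
    fun t h hi hm => by
      rw [← hstat t h hi (LazyWalk.measurable_uncurry hm)]
      simp_rw [LazyWalk.ofReal_ekernelPow]
  have hgood : ∀ᵐ ω ∂μ, LazyWalk.Good ω.1 := by
    filter_upwards [hgraph] with ω hω x
    exact ⟨hω.2.1 x, hω.2.2.1 x, hω.2.2.2 x⟩
  refine ⟨fun s t hst => ?_, fun s t hst => ?_, ?_⟩
  · obtain ⟨k, rfl⟩ := Nat.exists_eq_add_of_le hst
    simp only [Nat.add_sub_cancel_left]
    refine Measure.ext fun C hC => ?_
    have hm := LazyWalk.measurable_logProb hC k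
    have h0 := hwalk'.map_log_apply 0 k hC
    rw [zero_add] at h0
    rw [hwalk'.map_log_apply s k hC, h0, hstat' s _ (LazyWalk.invariant_logProb k C) hm,
      hstat' 0 _ (LazyWalk.invariant_logProb k C) hm]
  · obtain ⟨k, rfl⟩ := Nat.exists_eq_add_of_le hst
    simp only [Nat.add_sub_cancel_left]
    filter_upwards [hwalk'.ae_zero, hwalk'.ae_stepPow_ne_zero s k] with ω h0 hω
    rw [h0]
    exact LazyWalk.neg_log_ekernelPow_add_le hω.1 hω.2
  · simp_rw [LazyWalk.tsum_mul_log_eq]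
    refine LazyWalk.exists_tendsto_entropy_toReal measurable_fst hgood (fun h hi hm => ?_) hint
    rw [← hstat' 1 h hi hm]
    simp_rw [LazyWalk.stepPow_one]
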